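/- arXiv:1307.0978 — 2 statements merged into one kernel-verified Lean document; each statement's English description precedes it below -/
import Mathlib

section
/- Let θ₀ ∈ ℝ and let π be drawn from the Mallows model M_{n,θ₀}. Define LD̃_n(π,t) := Inv(π)/n² − C'(t) and ML̃_n(π,t) := Inv(π)/n² − (1/n)(d/dt)C_n(t). Then M_{n,θ₀}({π : t ↦ LD̃_n(π,t) has exactly one zero in ℝ}) → 1 as n → ∞, and for every δ > 0, M_{n,θ₀}({π : there exists t with LD̃_n(π,t) = 0 and |t − θ₀| > δ}) → 0; the same two assertions hold with ML̃_n in place of LD̃_n. -/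
open MeasureTheory Filter Topology
open scoped ENNReal

noncomputable section

/-- The unit square `[0,1]²` in `ℝ × ℝ`. -/
def unitSq : Set (ℝ × ℝ) := Set.Icc 0 1 ×ˢ Set.Icc 0 1

/-- Lebesgue measure restricted to `[0,1]`. -/
def unif01 : Measure ℝ := volume.restrict (Set.Icc 0 1)

/-- Lebesgue (uniform) measure on the unit square. -/
def usq : Measure (ℝ × ℝ) := unif01.prod unif01

/-- `𝓜`: Borel probability measures on `[0,1]²` with both marginals Lebesgue on `[0,1]`. -/
def MM : Set (Measure (ℝ × ℝ)) :=
  {μ | IsProbabilityMeasure μ ∧ μ.map Prod.fst = unif01 ∧ μ.map Prod.snd = unif01}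

/-- The class `𝓒` of continuous functions on the unit square, not identically zero,
with all row and column integrals vanishing. -/
def memC (f : ℝ × ℝ → ℝ) : Prop :=
  ContinuousOn f unitSq ∧ (∃ p ∈ unitSq, f p ≠ 0) ∧
    (∀ x ∈ Set.Icc (0 : ℝ) 1, (∫ z in (0 : ℝ)..1, f (x, z)) = 0) ∧
    (∀ y ∈ Set.Icc (0 : ℝ) 1, (∫ z in (0 : ℝ)..1, f (z, y)) = 0)

open scoped Classical in
/-- Kullback–Leibler divergence `D(μ‖ν)`, equal to `∫ log(dμ/dν) dμ` when `μ ≪ ν`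
(and this integral exists), and `+∞` otherwise. -/
def KL (μ ν : Measure (ℝ × ℝ)) : ℝ≥0∞ :=
  if μ ≪ ν ∧ Integrable (fun x => Real.log ((μ.rnDeriv ν x).toReal)) μ then
    ENNReal.ofReal (∫ x, Real.log ((μ.rnDeriv ν x).toReal) ∂μ)
  else ⊤

/-- The objective `θ μ[f] − D(μ‖u)`, as an extended real. -/
def objE (f : ℝ × ℝ → ℝ) (θ : ℝ) (μ : Measure (ℝ × ℝ)) : EReal :=
  ((θ * ∫ p, f p ∂μ : ℝ) : EReal) - (KL μ usq : EReal)

/-- `∑_{i=1}^n f(i/n, π(i)/n)`. -/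
def permStat (f : ℝ × ℝ → ℝ) (n : ℕ) (π : Equiv.Perm (Fin n)) : ℝ :=
  ∑ i : Fin n, f ((i.1 + 1 : ℝ) / n, ((π i).1 + 1 : ℝ) / n)

/-- The log normalizing constant `Z_n(f,θ)`. -/
def Zn (f : ℝ × ℝ → ℝ) (θ : ℝ) (n : ℕ) : ℝ :=
  Real.log (∑ π : Equiv.Perm (Fin n), Real.exp (θ * permStat f n π))

open scoped Classical in
/-- The probability that a sample from `Q_{n,f,θ}` satisfies `p`. -/
def Qprob (f : ℝ × ℝ → ℝ) (θ : ℝ) (n : ℕ) (p : Equiv.Perm (Fin n) → Prop) : ℝ :=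
  ∑ π : Equiv.Perm (Fin n), if p π then Real.exp (θ * permStat f n π - Zn f θ n) else 0

open scoped Classical in
/-- `Inv(π)`, the number of inversions of `π`. -/
def numInv (n : ℕ) (π : Equiv.Perm (Fin n)) : ℕ :=
  (Finset.univ.filter (fun p : Fin n × Fin n => p.1 < p.2 ∧ π p.2 < π p.1)).card

/-- `C_n(θ)`, the log normalizing constant of the Mallows model with Kendall's tau. -/
def Cn (θ : ℝ) (n : ℕ) : ℝ :=
  Real.log (∑ π : Equiv.Perm (Fin n), Real.exp (θ / n * numInv n π))

/-- `(μ×μ)(h)` where `h((x₁,y₁),(x₂,y₂)) = 1{(x₁−x₂)(y₁−y₂) < 0}`. -/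
def Hfun (μ : Measure (ℝ × ℝ)) : ℝ :=
  ((μ.prod μ) {p : (ℝ × ℝ) × (ℝ × ℝ) | (p.1.1 - p.2.1) * (p.1.2 - p.2.2) < 0}).toReal

/-- The Mallows objective `(θ/2)(μ×μ)(h) − D(μ‖u)`, as an extended real. -/
def objM (θ : ℝ) (μ : Measure (ℝ × ℝ)) : EReal :=
  ((θ / 2 * Hfun μ : ℝ) : EReal) - (KL μ usq : EReal)

/-- The limiting Mallows log normalizing constant `C(t) = ∫₀¹ log((e^{tx}−1)/(tx)) dx`
for `t ≠ 0`, with `C(0) = 0`. -/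
def Cfun (t : ℝ) : ℝ :=
  if t = 0 then 0 else ∫ x in (0 : ℝ)..1, Real.log ((Real.exp (t * x) - 1) / (t * x))

open scoped Classical in
/-- The probability that a sample from the Mallows model `M_{n,θ}` satisfies `p`. -/
def Mprob (θ : ℝ) (n : ℕ) (p : Equiv.Perm (Fin n) → Prop) : ℝ :=
  ∑ π : Equiv.Perm (Fin n), if p π then Real.exp (θ / n * numInv n π - Cn θ n) else 0


/-- If `X` has all exponential moments and is not almost surely constant, then the derivative of
its cumulant generating function is strictly increasing. -/
lemma strictMono_deriv_cgf {Ω : Type*} [MeasurableSpace Ω] {μ : Measure Ω} {X : Ω → ℝ}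
    (h : ProbabilityTheory.integrableExpSet X μ = Set.univ)
    (hX : ∀ c : ℝ, ¬ X =ᵐ[μ] fun _ => c) :
    StrictMono (deriv (ProbabilityTheory.cgf X μ)) := by
  refine strictMono_of_deriv_pos fun t => ?_
  have ht : t ∈ interior (ProbabilityTheory.integrableExpSet X μ) := by simp [h]
  have hi : Integrable (fun ω => Real.exp (t * X ω)) μ :=
    interior_subset (s := ProbabilityTheory.integrableExpSet X μ) ht
  have hv := ProbabilityTheory.variance_tilted_mul ht
  rw [iteratedDeriv_succ, iteratedDeriv_one] at hv
  rw [← hv]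
  refine lt_of_le_of_ne (ProbabilityTheory.variance_nonneg _ _) fun h0 => ?_
  have hae := ProbabilityTheory.ae_eq_integral_of_variance_eq_zero
    (by simpa using ProbabilityTheory.memLp_tilted_mul ht 2) h0.symm
  exact hX _ ((absolutelyContinuous_tilted hi).ae_le hae)

lemma contDiff_cgf {Ω : Type*} [MeasurableSpace Ω] {μ : Measure Ω} {X : Ω → ℝ}
    (h : ProbabilityTheory.integrableExpSet X μ = Set.univ) :
    ContDiff ℝ 1 (ProbabilityTheory.cgf X μ) := by
  have ha := ProbabilityTheory.analyticOnNhd_cgf (X := X) (μ := μ)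
  rw [h, interior_univ] at ha
  exact ha.contDiff

instance : IsProbabilityMeasure unif01 := ⟨by simp [unif01]⟩

/-- The cumulant generating function of the uniform distribution on `[0,1]`. -/
def unifCgf : ℝ → ℝ := ProbabilityTheory.cgf id unif01

lemma integrableExpSet_unif01 : ProbabilityTheory.integrableExpSet id unif01 = Set.univ := by
  refine Set.eq_univ_of_forall fun t => ?_
  have : ContinuousOn (fun x : ℝ => Real.exp (t * id x)) (Set.Icc 0 1) := by fun_prop
  exact this.integrableOn_compact isCompact_Icc

lemma contDiff_unifCgf : ContDiff ℝ 1 unifCgf := contDiff_cgf integrableExpSet_unif01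

lemma hasDerivAt_unifCgf (u : ℝ) : HasDerivAt unifCgf (deriv unifCgf u) u :=
  (contDiff_unifCgf.differentiable one_ne_zero u).hasDerivAt

lemma continuous_deriv_unifCgf : Continuous (deriv unifCgf) :=
  contDiff_unifCgf.continuous_deriv le_rfl

lemma strictMono_deriv_unifCgf : StrictMono (deriv unifCgf) := by
  refine strictMono_deriv_cgf integrableExpSet_unif01 fun c hc => ?_
  have h1 : ∀ᵐ x ∂unif01, x ≠ c := by
    refine ae_restrict_of_ae ?_
    simp [ae_iff]
  have h2 : ∀ᵐ _ ∂unif01, False := by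
    filter_upwards [hc, h1] with x hx hx' using hx' hx
  simp at h2
  exact IsProbabilityMeasure.ne_zero _ h2

lemma unifCgf_zero : unifCgf 0 = 0 := ProbabilityTheory.cgf_zero

lemma unifCgf_eq {u : ℝ} (hu : u ≠ 0) : unifCgf u = Real.log ((Real.exp u - 1) / u) := by
  unfold unifCgf ProbabilityTheory.cgf ProbabilityTheory.mgf unif01
  congr 1
  rw [integral_Icc_eq_integral_Ioc, ← intervalIntegral.integral_of_le zero_le_one]
  simp only [id]
  rw [intervalIntegral.integral_comp_mul_left (fun x => Real.exp x) hu]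
  simp [div_eq_inv_mul]

lemma exp_unifCgf {u : ℝ} (hu : u ≠ 0) : Real.exp (unifCgf u) = (Real.exp u - 1) / u := by
  rw [unifCgf_eq hu, Real.exp_log]
  rcases lt_or_gt_of_ne hu with h | h
  · exact div_pos_of_neg_of_neg (by simpa using h) h
  · exact div_pos (by simpa using h) h

lemma Cfun_eq_integral (t : ℝ) : Cfun t = ∫ x in (0 : ℝ)..1, unifCgf (t * x) := by
  unfold Cfun
  split_ifs with h
  · simp [h, unifCgf_zero]
  · rw [intervalIntegral.integral_of_le zero_le_one, intervalIntegral.integral_of_le zero_le_one]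
    refine setIntegral_congr_fun measurableSet_Ioc fun x hx => ?_
    exact (unifCgf_eq (mul_ne_zero h hx.1.ne')).symm

lemma hasDerivAt_Cfun (t : ℝ) :
    HasDerivAt Cfun (∫ x in (0 : ℝ)..1, deriv unifCgf (t * x) * x) t := by
  rw [funext Cfun_eq_integral]
  have hc := contDiff_unifCgf.continuous
  have hc' := continuous_deriv_unifCgf
  obtain ⟨M, hM⟩ := (isCompact_Icc (a := -(|t| + 1)) (b := |t| + 1)).exists_bound_of_continuousOn
    hc'.continuousOn
  refine (intervalIntegral.hasDerivAt_integral_of_dominated_loc_of_deriv_le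
    (F := fun t x => unifCgf (t * x)) (F' := fun t x => deriv unifCgf (t * x) * x)
    (bound := fun _ => M) (Metric.ball_mem_nhds t one_pos) ?_ ?_ ?_ ?_ ?_ ?_).2
  · exact .of_forall fun s =>
      (by fun_prop : Continuous fun x => unifCgf (s * x)).aestronglyMeasurable
  · exact (by fun_prop : Continuous fun x => unifCgf (t * x)).intervalIntegrable _ _
  · exact (by fun_prop : Continuous fun x => deriv unifCgf (t * x) * x).aestronglyMeasurable
  · refine .of_forall fun x hx s hs => ?_
    rw [Set.uIoc_of_le zero_le_one] at hx
    have hs' : |s| ≤ |t| + 1 := by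
      have h1 : |s - t| < 1 := by simpa [Real.dist_eq] using hs
      have h2 := abs_add_le (s - t) t
      rw [sub_add_cancel] at h2
      linarith
    have hsx : |s * x| ≤ |t| + 1 := by
      rw [abs_mul, abs_of_pos hx.1]
      nlinarith [hx.1, hx.2, abs_nonneg s]
    have hb := hM (s * x) (abs_le.mp hsx)
    rw [norm_mul, Real.norm_of_nonneg hx.1.le]
    nlinarith [hx.1, hx.2, norm_nonneg (deriv unifCgf (s * x))]
  · exact intervalIntegrable_const
  · refine .of_forall fun x _ s _ => ?_
    have h := (hasDerivAt_unifCgf (s * x)).comp s ((hasDerivAt_id s).mul_const x)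
    rw [one_mul] at h
    exact h

lemma deriv_Cfun : deriv Cfun = fun t => ∫ x in (0 : ℝ)..1, deriv unifCgf (t * x) * x :=
  funext fun t => (hasDerivAt_Cfun t).deriv

lemma continuous_deriv_Cfun : Continuous (deriv Cfun) := by
  rw [deriv_Cfun]
  have hc' := continuous_deriv_unifCgf
  exact intervalIntegral.continuous_parametric_intervalIntegral_of_continuous' (by fun_prop) _ _

lemma strictMono_deriv_Cfun : StrictMono (deriv Cfun) := by
  rw [deriv_Cfun]
  intro s t hst
  have hc' := continuous_deriv_unifCgf
  refine intervalIntegral.integral_lt_integral_of_continuousOn_of_le_of_exists_lt one_pos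
    (by fun_prop) (by fun_prop) (fun x hx => ?_) ⟨1, by simp, ?_⟩
  · exact mul_le_mul_of_nonneg_right
      (strictMono_deriv_unifCgf.monotone (mul_le_mul_of_nonneg_right hst.le hx.1.le)) hx.1.le
  · simpa using strictMono_deriv_unifCgf hst

lemma sum_exp_geom (t : ℝ) (n m : ℕ) (hn : 0 < n) (hm : 0 < m) :
    ∑ j ∈ Finset.range m, Real.exp (t / n * j) =
      m * Real.exp (unifCgf (t * (m / n)) - unifCgf (t / n)) := by
  rcases eq_or_ne t 0 with rfl | ht
  · simp
  have hn' : (n : ℝ) ≠ 0 := by positivity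
  have hm' : (m : ℝ) ≠ 0 := by positivity
  have h1 : t / n ≠ 0 := div_ne_zero ht hn'
  have hne : Real.exp (t / n) ≠ 1 := by simpa using h1
  have hsum : ∑ j ∈ Finset.range m, Real.exp (t / n * j) =
      ∑ j ∈ Finset.range m, Real.exp (t / n) ^ j :=
    Finset.sum_congr rfl fun j _ => by rw [mul_comm, Real.exp_nat_mul]
  rw [hsum, geom_sum_eq hne, ← Real.exp_nat_mul, Real.exp_sub, exp_unifCgf (by positivity),
    exp_unifCgf h1, show (m : ℝ) * (t / n) = t * (m / n) by ring]
  have : Real.exp (t / n) - 1 ≠ 0 := sub_ne_zero.mpr hne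
  field_simp

/-- The permutation of `Fin (n + 1)` sending `0` to `p` whose remaining values are ordered
as those of `e`. -/
def permCons (n : ℕ) (x : Fin (n + 1) × Equiv.Perm (Fin n)) : Equiv.Perm (Fin (n + 1)) :=
  ((finSuccEquiv' 0).trans (Equiv.optionCongr x.2)).trans (finSuccEquiv' x.1).symm

lemma permCons_zero (n : ℕ) (x : Fin (n + 1) × Equiv.Perm (Fin n)) : permCons n x 0 = x.1 := by
  simp [permCons]

lemma permCons_succ (n : ℕ) (x : Fin (n + 1) × Equiv.Perm (Fin n)) (i : Fin n) :
    permCons n x i.succ = x.1.succAbove (x.2 i) := by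
  simp [permCons, finSuccEquiv'_zero]

lemma permCons_bijective (n : ℕ) : Function.Bijective (permCons n) := by
  rw [Fintype.bijective_iff_injective_and_card]
  refine ⟨fun x y h => ?_, by simp [Fintype.card_perm, Nat.factorial_succ]⟩
  have h0 : x.1 = y.1 := by rw [← permCons_zero, h, permCons_zero]
  refine Prod.ext h0 (Equiv.ext fun i => ?_)
  have hi : permCons n x i.succ = permCons n y i.succ := by rw [h]
  rw [permCons_succ, permCons_succ, h0] at hi
  exact Fin.succAbove_right_injective hi

lemma numInv_eq_sum (n : ℕ) (π : Equiv.Perm (Fin n)) :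
    numInv n π = ∑ i, ∑ j, if i < j ∧ π j < π i then 1 else 0 := by
  rw [numInv, Finset.card_filter, Fintype.sum_prod_type]

lemma numInv_permCons (n : ℕ) (x : Fin (n + 1) × Equiv.Perm (Fin n)) :
    numInv (n + 1) (permCons n x) = x.1 + numInv n x.2 := by
  rw [numInv_eq_sum, numInv_eq_sum, Fin.sum_univ_succ]
  simp only [Fin.sum_univ_succ, permCons_zero, permCons_succ, Fin.succ_lt_succ_iff,
    Fin.not_lt_zero, Fin.succ_pos, lt_self_iff_false, false_and, true_and, if_false, zero_add,
    (Fin.strictMono_succAbove _).lt_iff_lt]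
  congr 1
  rw [Equiv.sum_comp x.2 (fun j => if x.1.succAbove j < x.1 then 1 else 0)]
  have h := Fin.sum_univ_succAbove (fun j => if j < x.1 then 1 else 0) x.1
  simp only [lt_self_iff_false, if_false, zero_add] at h
  rw [← h, ← Finset.card_filter, Finset.filter_gt_eq_Iio, Fin.card_Iio]

lemma sum_exp_numInv_succ (s : ℝ) (n : ℕ) :
    ∑ π : Equiv.Perm (Fin (n + 1)), Real.exp (s * numInv (n + 1) π) =
      (∑ j ∈ Finset.range (n + 1), Real.exp (s * j)) *
        ∑ π : Equiv.Perm (Fin n), Real.exp (s * numInv n π) := by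
  rw [← (permCons_bijective n).sum_comp, Fintype.sum_prod_type, Finset.sum_range,
    Finset.sum_mul_sum]
  refine Finset.sum_congr rfl fun i _ => Finset.sum_congr rfl fun e _ => ?_
  rw [numInv_permCons, ← Real.exp_add]
  push_cast
  ring_nf

lemma sum_exp_numInv (s : ℝ) (n : ℕ) :
    ∑ π : Equiv.Perm (Fin n), Real.exp (s * numInv n π) =
      ∏ k ∈ Finset.range n, ∑ j ∈ Finset.range (k + 1), Real.exp (s * j) := by
  induction n with
  | zero => simp [numInv]
  | succ n ih => rw [sum_exp_numInv_succ, ih, Finset.prod_range_succ, mul_comm]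

lemma Cn_eq (t : ℝ) (n : ℕ) (hn : 0 < n) :
    Cn t n = Real.log n.factorial + (∑ k ∈ Finset.range n, unifCgf (t * ((k + 1) / n)))
      - n * unifCgf (t / n) := by
  rw [Cn, sum_exp_numInv, Finset.prod_congr rfl fun k _ => sum_exp_geom t n (k + 1) hn k.succ_pos,
    Finset.prod_mul_distrib, ← Real.exp_sum, Real.log_mul, Real.log_exp, Finset.sum_sub_distrib,
    ← Nat.cast_prod, Finset.prod_range_add_one_eq_factorial]
  · simp
    ring
  · exact Finset.prod_ne_zero_iff.mpr fun k _ => by positivity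
  · positivity

/-- Right Riemann sums of a continuous function on `[0,1]` converge to its integral. -/
lemma tendsto_riemannSum {g : ℝ → ℝ} (hg : Continuous g) :
    Tendsto (fun n : ℕ => (∑ k ∈ Finset.range n, g ((k + 1) / n)) / n) atTop
      (𝓝 (∫ x in (0 : ℝ)..1, g x)) := by
  rw [Metric.tendsto_atTop]
  intro ε hε
  have huc := isCompact_Icc.uniformContinuousOn_of_continuous
    (hg.continuousOn (s := Set.Icc 0 1))
  obtain ⟨η, hη, huc⟩ := Metric.uniformContinuousOn_iff.mp huc (ε / 2) (by positivity)
  obtain ⟨N, hN⟩ := exists_nat_one_div_lt hη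
  refine ⟨N + 1, fun n hn => ?_⟩
  have hn0 : (0 : ℝ) < n := by exact_mod_cast (by omega : 0 < n)
  have hnη : 1 / (n : ℝ) < η :=
    lt_of_le_of_lt (one_div_le_one_div_of_le (by positivity) (by exact_mod_cast hn)) hN
  have hint : ∫ x in (0 : ℝ)..1, g x =
      ∑ k ∈ Finset.range n, ∫ x in ((k : ℝ) / n)..((k + 1 : ℕ) / n : ℝ), g x := by
    rw [intervalIntegral.sum_integral_adjacent_intervals (a := fun k : ℕ => (k : ℝ) / n)
      fun k _ => hg.intervalIntegrable _ _]
    simp [hn0.ne']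
  have hterm : ∀ k ∈ Finset.range n, ‖g ((k + 1) / n) / n -
      ∫ x in ((k : ℝ) / n)..((k + 1 : ℕ) / n : ℝ), g x‖ ≤ ε / 2 * (1 / n) := by
    intro k hk
    have hk' : ((k : ℝ) + 1) ≤ n := by exact_mod_cast Finset.mem_range.mp hk
    have hlen : ((k + 1 : ℕ) / n : ℝ) - k / n = 1 / n := by push_cast; ring
    have hle : (k : ℝ) / n ≤ ((k + 1 : ℕ) / n : ℝ) := by
      have : 0 < 1 / (n : ℝ) := by positivity
      linarith
    have heq : g ((k + 1) / n) / n - ∫ x in ((k : ℝ) / n)..((k + 1 : ℕ) / n : ℝ), g x =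
        ∫ x in ((k : ℝ) / n)..((k + 1 : ℕ) / n : ℝ), (g ((k + 1) / n) - g x) := by
      rw [intervalIntegral.integral_sub intervalIntegrable_const (hg.intervalIntegrable _ _),
        intervalIntegral.integral_const, hlen, smul_eq_mul]
      ring
    rw [heq]
    refine (intervalIntegral.norm_integral_le_of_norm_le_const (C := ε / 2) fun x hx => ?_).trans ?_
    · rw [Set.uIoc_of_le hle] at hx
      have h1 : ((k + 1 : ℕ) / n : ℝ) ≤ 1 := by
        rw [div_le_one hn0]; exact_mod_cast hk'
      have h0 : 0 ≤ (k : ℝ) / n := by positivity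
      have hx1 := hx.1
      have hx2 := hx.2
      have hd : dist (((k + 1 : ℕ) : ℝ) / n) x < η := by
        rw [Real.dist_eq, abs_of_nonneg (by linarith)]
        linarith
      have := huc _ ⟨by positivity, h1⟩ x ⟨by linarith, by linarith⟩ hd
      rw [Real.dist_eq] at this
      push_cast at this
      exact this.le
    · rw [hlen, abs_of_pos (by positivity)]
  rw [hint, Real.dist_eq, Finset.sum_div, ← Finset.sum_sub_distrib]
  refine ((Finset.abs_sum_le_sum_abs _ _).trans (Finset.sum_le_sum hterm)).trans_lt ?_
  rw [Finset.sum_const, Finset.card_range, nsmul_eq_mul]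
  field_simp
  linarith

lemma tendsto_Cn (t : ℝ) :
    Tendsto (fun n : ℕ => (Cn t n - Real.log n.factorial) / n) atTop (𝓝 (Cfun t)) := by
  have hc := contDiff_unifCgf.continuous
  have h1 := tendsto_riemannSum (g := fun x => unifCgf (t * x)) (by fun_prop)
  have h2 : Tendsto (fun n : ℕ => unifCgf (t / n)) atTop (𝓝 0) := by
    rw [← unifCgf_zero]
    exact (hc.tendsto 0).comp (tendsto_const_div_atTop_nhds_zero_nat t)
  have h := h1.sub h2
  rw [sub_zero, ← Cfun_eq_integral] at h
  refine h.congr' ?_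
  filter_upwards [eventually_gt_atTop 0] with n hn
  have : (n : ℝ) ≠ 0 := by positivity
  rw [Cn_eq t n hn]
  field_simp
  ring

/-- The log normalizing constant is continuously differentiable with strictly increasing
derivative, being the cumulant generating function of a non-constant statistic. -/
lemma contDiff_strictMono_deriv_Cn (n : ℕ) (hn : 2 ≤ n) :
    ContDiff ℝ 1 (fun s => Cn s n) ∧ StrictMono (deriv fun s => Cn s n) := by
  let _ : MeasurableSpace (Equiv.Perm (Fin n)) := ⊤
  have _ : DiscreteMeasurableSpace (Equiv.Perm (Fin n)) := ⟨fun _ => trivial⟩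
  let X : Equiv.Perm (Fin n) → ℝ := fun π => numInv n π / n
  have hset : ProbabilityTheory.integrableExpSet X Measure.count = Set.univ :=
    Set.eq_univ_of_forall fun t => Integrable.of_finite
  have heq : (fun s => Cn s n) = ProbabilityTheory.cgf X Measure.count := by
    funext s
    rw [Cn, ProbabilityTheory.cgf, ProbabilityTheory.mgf, integral_count]
    congr 1
    refine Finset.sum_congr rfl fun π _ => ?_
    congr 1
    simp only [X]
    ring
  rw [heq]
  refine ⟨contDiff_cgf hset, strictMono_deriv_cgf hset fun c hc => ?_⟩
  have hc' : ∀ π, X π = c := by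
    intro π
    by_contra h
    have := measure_mono_null (s := {π}) (by simpa using h) hc
    simp at this
  have h1 : numInv n 1 = 0 := by
    rw [numInv, Finset.card_eq_zero, Finset.filter_eq_empty_iff]
    rintro p - ⟨h, h'⟩
    exact absurd h (not_lt_of_gt h')
  have h2 : 0 < numInv n Fin.revPerm := by
    rw [numInv, Finset.card_pos]
    exact ⟨(⟨0, by omega⟩, ⟨1, by omega⟩), by simp⟩
  have h3 : X 1 = X Fin.revPerm := by rw [hc', hc']
  have hn0 : (0 : ℝ) < n := by exact_mod_cast (by omega : 0 < n)
  have h4 : (0 : ℝ) < numInv n Fin.revPerm / n := by positivity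
  simp only [X, h1, Nat.cast_zero, zero_div] at h3
  exact h4.ne h3

lemma deriv_lt_slope {f : ℝ → ℝ} (hf : Differentiable ℝ f) (hm : StrictMono (deriv f))
    {a b : ℝ} (hab : a < b) :
    deriv f a < (f b - f a) / (b - a) ∧ (f b - f a) / (b - a) < deriv f b := by
  obtain ⟨c, hc, h⟩ := exists_deriv_eq_slope f hab hf.continuous.continuousOn
    hf.differentiableOn
  rw [← h]
  exact ⟨hm hc.1, hm hc.2⟩

lemma sum_exp_sub_Cn (t : ℝ) (n : ℕ) :
    ∑ π : Equiv.Perm (Fin n), Real.exp (t / n * numInv n π - Cn t n) = 1 := by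
  simp_rw [Real.exp_sub]
  rw [← Finset.sum_div, Cn, Real.exp_log (Finset.sum_pos (fun _ _ => Real.exp_pos _) ⟨1, by simp⟩),
    div_self (Finset.sum_pos (fun _ _ => Real.exp_pos _) ⟨1, by simp⟩).ne']

lemma Mprob_nonneg (θ : ℝ) (n : ℕ) (p : Equiv.Perm (Fin n) → Prop) : 0 ≤ Mprob θ n p :=
  Finset.sum_nonneg fun _ _ => by split_ifs <;> positivity

lemma Mprob_mono (θ : ℝ) (n : ℕ) {p q : Equiv.Perm (Fin n) → Prop} (h : ∀ π, p π → q π) :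
    Mprob θ n p ≤ Mprob θ n q := by
  refine Finset.sum_le_sum fun π _ => ?_
  split_ifs with h1 h2
  · exact le_rfl
  · exact absurd (h π h1) h2
  · positivity
  · exact le_rfl

lemma Mprob_add_not (θ : ℝ) (n : ℕ) (p : Equiv.Perm (Fin n) → Prop) :
    Mprob θ n p + Mprob θ n (fun π => ¬ p π) = 1 := by
  rw [Mprob, Mprob, ← Finset.sum_add_distrib, ← sum_exp_sub_Cn θ n]
  refine Finset.sum_congr rfl fun π _ => ?_
  by_cases h : p π <;> simp [h]

lemma Mprob_or_le (θ : ℝ) (n : ℕ) (p q : Equiv.Perm (Fin n) → Prop) :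
    Mprob θ n (fun π => p π ∨ q π) ≤ Mprob θ n p + Mprob θ n q := by
  rw [Mprob, Mprob, Mprob, ← Finset.sum_add_distrib]
  refine Finset.sum_le_sum fun π _ => ?_
  by_cases h : p π <;> by_cases h' : q π <;> simp [h, h', Real.exp_nonneg]

/-- Chernoff bound for the number of inversions. -/
lemma Mprob_chernoff (θ s a : ℝ) (n : ℕ) :
    Mprob θ n (fun π => s * a ≤ s * ((numInv n π : ℝ) / n ^ 2)) ≤
      Real.exp (Cn (θ + s) n - Cn θ n - n * (s * a)) := by
  have h : Real.exp (Cn (θ + s) n - Cn θ n - n * (s * a)) =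
      ∑ π : Equiv.Perm (Fin n), Real.exp ((θ + s) / n * numInv n π - Cn (θ + s) n) *
        Real.exp (Cn (θ + s) n - Cn θ n - n * (s * a)) := by
    rw [← Finset.sum_mul, sum_exp_sub_Cn, one_mul]
  rw [h]
  refine Finset.sum_le_sum fun π _ => ?_
  split_ifs with hp
  · rw [← Real.exp_add]
    refine Real.exp_le_exp.mpr ?_
    have h1 := mul_le_mul_of_nonneg_left hp (Nat.cast_nonneg (α := ℝ) n)
    have h2 : (n : ℝ) * (s * ((numInv n π : ℝ) / n ^ 2)) = s / n * numInv n π := by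
      rcases eq_or_ne (n : ℝ) 0 with h0 | h0
      · simp [h0]
      · field_simp
    rw [add_div, add_mul]
    linarith
  · positivity

lemma tendsto_Mprob_of_Cfun_lt {θ s a : ℝ} (h : Cfun (θ + s) - Cfun θ < s * a) :
    Tendsto (fun n : ℕ => Mprob θ n (fun π => s * a ≤ s * ((numInv n π : ℝ) / n ^ 2)))
      atTop (𝓝 0) := by
  refine squeeze_zero (fun n => Mprob_nonneg _ _ _) (fun n => Mprob_chernoff θ s a n) ?_
  refine Real.tendsto_exp_atBot.comp ?_
  have h1 := ((tendsto_Cn (θ + s)).sub (tendsto_Cn θ)).sub_const (s * a)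
  refine (tendsto_natCast_atTop_atTop.atTop_mul_neg (sub_neg.mpr h) h1).congr' ?_
  filter_upwards [eventually_gt_atTop 0] with n hn
  have : (n : ℝ) ≠ 0 := by positivity
  field_simp
  ring

lemma exists_Cfun_lt {θ a : ℝ} (ha : a ≠ deriv Cfun θ) :
    ∃ s, 0 < s * (a - deriv Cfun θ) ∧ Cfun (θ + s) - Cfun θ < s * a := by
  have hd : Differentiable ℝ Cfun := fun t => (hasDerivAt_Cfun t).differentiableAt
  have hlt {a b : ℝ} (hab : a < b) := deriv_lt_slope hd strictMono_deriv_Cfun hab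
  have hcont := continuous_deriv_Cfun.tendsto θ
  rcases lt_or_gt_of_ne ha with h | h
  · obtain ⟨η, hη, hb⟩ := Metric.eventually_nhds_iff.mp (hcont.eventually_const_lt h)
    refine ⟨-(η / 2), by nlinarith, ?_⟩
    have h1 := hb (y := θ + -(η / 2)) (by rw [Real.dist_eq, abs_lt]; constructor <;> linarith)
    have h2 := h1.trans (hlt (a := θ + -(η / 2)) (b := θ) (by linarith)).1
    rw [lt_div_iff₀ (by linarith)] at h2
    linarith
  · obtain ⟨η, hη, hb⟩ := Metric.eventually_nhds_iff.mp (hcont.eventually_lt_const h)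
    refine ⟨η / 2, by nlinarith, ?_⟩
    have h1 := hb (y := θ + η / 2) (by rw [Real.dist_eq, abs_lt]; constructor <;> linarith)
    have h2 := (hlt (a := θ) (b := θ + η / 2) (by linarith)).2.trans h1
    rw [div_lt_iff₀ (by linarith)] at h2
    linarith

/-- Law of large numbers for the number of inversions under the Mallows model. -/
lemma tendsto_Mprob_numInv (θ : ℝ) {ε : ℝ} (hε : 0 < ε) :
    Tendsto (fun n : ℕ => Mprob θ n
      (fun π => ¬ |(numInv n π : ℝ) / n ^ 2 - deriv Cfun θ| < ε)) atTop (𝓝 0) := by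
  obtain ⟨s, hs, hs'⟩ := exists_Cfun_lt (θ := θ) (a := deriv Cfun θ + ε) (by linarith)
  obtain ⟨r, hr, hr'⟩ := exists_Cfun_lt (θ := θ) (a := deriv Cfun θ - ε) (by linarith)
  have h := (tendsto_Mprob_of_Cfun_lt hs').add (tendsto_Mprob_of_Cfun_lt hr')
  rw [add_zero] at h
  refine squeeze_zero (fun n => Mprob_nonneg _ _ _) (fun n => ?_) h
  refine (Mprob_mono θ n fun π hπ => ?_).trans (Mprob_or_le θ n _ _)
  rw [not_lt, le_abs] at hπ
  refine hπ.imp (fun h => ?_) (fun h => ?_)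
  · exact mul_le_mul_of_nonneg_left (by linarith) (by nlinarith)
  · exact mul_le_mul_of_nonpos_left (by linarith) (by nlinarith)

/-- Roots of strictly increasing estimating equations that separate `deriv Cfun θ` from their
values away from `θ` are eventually unique and consistent. -/
lemma estimator_consistent (θ : ℝ) (g : ℕ → ℝ → ℝ)
    (hg : ∀ᶠ n in atTop, StrictMono (g n) ∧ Continuous (g n))
    (hsep : ∀ δ > 0, ∃ ε > 0, ∀ᶠ n in atTop,
      g n (θ - δ) < deriv Cfun θ - ε ∧ deriv Cfun θ + ε < g n (θ + δ)) :
    Tendsto (fun n : ℕ => Mprob θ n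
      (fun π => ∃! t : ℝ, (numInv n π : ℝ) / n ^ 2 - g n t = 0)) atTop (𝓝 1) ∧
    ∀ δ > 0, Tendsto (fun n : ℕ => Mprob θ n
      (fun π => ∃ t : ℝ, (numInv n π : ℝ) / n ^ 2 - g n t = 0 ∧ δ < |t - θ|)) atTop (𝓝 0) := by
  constructor
  · obtain ⟨ε, hε, hs⟩ := hsep 1 one_pos
    have h := (tendsto_Mprob_numInv θ hε).const_sub 1
    rw [sub_zero] at h
    refine tendsto_of_tendsto_of_tendsto_of_le_of_le' h tendsto_const_nhds ?_
      (.of_forall fun n => ?_)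
    · filter_upwards [hg, hs] with n hgn hsn
      have h1 := Mprob_add_not θ n (fun π => |(numInv n π : ℝ) / n ^ 2 - deriv Cfun θ| < ε)
      refine (sub_le_iff_le_add.mpr h1.ge).trans (Mprob_mono θ n fun π hπ => ?_)
      rw [abs_lt] at hπ
      obtain ⟨t, -, ht⟩ := intermediate_value_Icc (by linarith : θ - 1 ≤ θ + 1)
        hgn.2.continuousOn (show (numInv n π : ℝ) / n ^ 2 ∈ Set.Icc _ _ from
          ⟨by linarith, by linarith⟩)
      exact ⟨t, by simp [ht], fun u hu => hgn.1.injective (by linarith)⟩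
    · have h1 := Mprob_add_not θ n (fun π => ∃! t : ℝ, (numInv n π : ℝ) / n ^ 2 - g n t = 0)
      linarith [Mprob_nonneg θ n
        (fun π => ¬ ∃! t : ℝ, (numInv n π : ℝ) / n ^ 2 - g n t = 0)]
  · intro δ hδ
    obtain ⟨ε, hε, hs⟩ := hsep δ hδ
    refine tendsto_of_tendsto_of_tendsto_of_le_of_le' tendsto_const_nhds
      (tendsto_Mprob_numInv θ hε) (.of_forall fun n => Mprob_nonneg _ _ _) ?_
    filter_upwards [hg, hs] with n hgn hsn
    refine Mprob_mono θ n fun π ⟨t, ht, htδ⟩ hπ => ?_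
    rw [abs_lt] at hπ
    rcases lt_abs.mp htδ with h | h
    · linarith [hgn.1.monotone (show θ + δ ≤ t by linarith)]
    · linarith [hgn.1.monotone (show t ≤ θ - δ by linarith)]

lemma deriv_Cn_separation (θ : ℝ) {δ : ℝ} (hδ : 0 < δ) :
    ∃ ε > 0, ∀ᶠ n : ℕ in atTop, deriv (fun s => Cn s n) (θ - δ) / n < deriv Cfun θ - ε ∧
      deriv Cfun θ + ε < deriv (fun s => Cn s n) (θ + δ) / n := by
  have hd : Differentiable ℝ Cfun := fun t => (hasDerivAt_Cfun t).differentiableAt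
  have hup := (deriv_lt_slope hd strictMono_deriv_Cfun (show θ < θ + δ by linarith)).1
  have hlo := (deriv_lt_slope hd strictMono_deriv_Cfun (show θ - δ < θ by linarith)).2
  obtain ⟨b, hb, hb'⟩ := exists_between hup
  obtain ⟨a, ha, ha'⟩ := exists_between hlo
  refine ⟨min (b - deriv Cfun θ) (deriv Cfun θ - a), lt_min (by linarith) (by linarith), ?_⟩
  have tup := (((tendsto_Cn (θ + δ)).sub (tendsto_Cn θ)).div_const
    (θ + δ - θ)).eventually_const_lt hb'
  have tlo := (((tendsto_Cn θ).sub (tendsto_Cn (θ - δ))).div_const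
    (θ - (θ - δ))).eventually_lt_const ha
  filter_upwards [tup, tlo, eventually_ge_atTop 2] with n hu hl hn
  have hn0 : (0 : ℝ) < n := by exact_mod_cast (by omega : 0 < n)
  obtain ⟨hC, hM⟩ := contDiff_strictMono_deriv_Cn n hn
  have hdn := hC.differentiable one_ne_zero
  have su := (deriv_lt_slope hdn hM (show θ < θ + δ by linarith)).2
  have sl := (deriv_lt_slope hdn hM (show θ - δ < θ by linarith)).1
  rw [← div_lt_div_iff_of_pos_right hn0] at su sl
  have eu : (Cn (θ + δ) n - Cn θ n) / (θ + δ - θ) / n =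
      ((Cn (θ + δ) n - Real.log n.factorial) / n - (Cn θ n - Real.log n.factorial) / n) /
        (θ + δ - θ) := by ring
  have el : (Cn θ n - Cn (θ - δ) n) / (θ - (θ - δ)) / n =
      ((Cn θ n - Real.log n.factorial) / n - (Cn (θ - δ) n - Real.log n.factorial) / n) /
        (θ - (θ - δ)) := by ring
  rw [eu] at su
  rw [el] at sl
  constructor
  · linarith [min_le_right (b - deriv Cfun θ) (deriv Cfun θ - a)]
  · linarith [min_le_left (b - deriv Cfun θ) (deriv Cfun θ - a)]

lemma deriv_Cfun_separation (θ : ℝ) {δ : ℝ} (hδ : 0 < δ) :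
    ∃ ε > 0, ∀ᶠ _ : ℕ in atTop, deriv Cfun (θ - δ) < deriv Cfun θ - ε ∧
      deriv Cfun θ + ε < deriv Cfun (θ + δ) := by
  obtain ⟨b, hb, hb'⟩ := exists_between (strictMono_deriv_Cfun (show θ < θ + δ by linarith))
  obtain ⟨a, ha, ha'⟩ := exists_between (strictMono_deriv_Cfun (show θ - δ < θ by linarith))
  refine ⟨min (b - deriv Cfun θ) (deriv Cfun θ - a), lt_min (by linarith) (by linarith),
    .of_forall fun _ => ⟨?_, ?_⟩⟩
  · linarith [min_le_right (b - deriv Cfun θ) (deriv Cfun θ - a)]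
  · linarith [min_le_left (b - deriv Cfun θ) (deriv Cfun θ - a)]

/-- For the Mallows model with Kendall's tau, both estimating equations
`LD̃_n(π,·) = 0` and `ML̃_n(π,·) = 0` have a unique root with probability tending to one,
and these roots are consistent for `θ₀`. -/
theorem mallows_estimators_consistent (θ₀ : ℝ) :
    (Tendsto (fun n : ℕ => Mprob θ₀ n
        (fun π => ∃! t : ℝ, (numInv n π : ℝ) / n ^ 2 - deriv Cfun t = 0))
      atTop (𝓝 1)) ∧
    (∀ δ > 0, Tendsto (fun n : ℕ => Mprob θ₀ n
        (fun π => ∃ t : ℝ, (numInv n π : ℝ) / n ^ 2 - deriv Cfun t = 0 ∧ δ < |t - θ₀|))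
      atTop (𝓝 0)) ∧
    (Tendsto (fun n : ℕ => Mprob θ₀ n
        (fun π => ∃! t : ℝ,
          (numInv n π : ℝ) / n ^ 2 - deriv (fun s => Cn s n) t / n = 0))
      atTop (𝓝 1)) ∧
    (∀ δ > 0, Tendsto (fun n : ℕ => Mprob θ₀ n
        (fun π => ∃ t : ℝ,
          (numInv n π : ℝ) / n ^ 2 - deriv (fun s => Cn s n) t / n = 0 ∧ δ < |t - θ₀|))
      atTop (𝓝 0)) := by
  have h1 := estimator_consistent θ₀ (fun _ => deriv Cfun)
    (.of_forall fun _ => ⟨strictMono_deriv_Cfun, continuous_deriv_Cfun⟩)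
    fun δ hδ => deriv_Cfun_separation θ₀ hδ
  have h2 := estimator_consistent θ₀ (fun n t => deriv (fun s => Cn s n) t / n) ?_
    fun δ hδ => deriv_Cn_separation θ₀ hδ
  · exact ⟨h1.1, h1.2, h2.1, h2.2⟩
  · filter_upwards [eventually_ge_atTop 2] with n hn
    obtain ⟨hC, hM⟩ := contDiff_strictMono_deriv_Cn n hn
    have hn0 : (0 : ℝ) < n := by exact_mod_cast (by omega : 0 < n)
    exact ⟨fun a b hab => div_lt_div_of_pos_right (hM hab) hn0,
      (hC.continuous_deriv le_rfl).div_const _⟩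
end
end

section
/- Fix k ∈ ℕ, μ₀ ∈ 𝓜 and ε > 0, and let π be drawn from P_n, the uniform distribution on S_n. Then lim_{n→∞} (1/n) log P_n({π ∈ S_n : M(π) ∈ V_n[k,μ₀](ε)}) = − inf_{A ∈ V[k,μ₀](ε)} D_k(A). -/
open MeasureTheory Filter Topology
open scoped ENNReal

noncomputable section

open scoped Classical in
/-- The interval `I_r ⊆ [0,1]`: `I_1 = [0, 1/k]` and `I_r = ((r−1)/k, r/k]` for `r ≥ 2`
(`r : Fin k` stands for `r+1 ∈ {1,…,k}`). -/
def Ik (k : ℕ) (r : Fin k) : Set ℝ :=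
  if r.1 = 0 then Set.Icc 0 (1 / k) else Set.Ioc ((r.1 : ℝ) / k) ((r.1 + 1 : ℝ) / k)

/-- The square `T_{rs} = I_r × I_s`. -/
def Trs (k : ℕ) (r s : Fin k) : Set (ℝ × ℝ) := Ik k r ×ˢ Ik k s

open scoped Classical in
/-- The `k×k` matrix `M(π)` with `M_{rs}(π) = #{i : (i/n, π(i)/n) ∈ T_{rs}}`. -/
def Mmat (k n : ℕ) (π : Equiv.Perm (Fin n)) : Matrix (Fin k) (Fin k) ℕ :=
  Matrix.of fun r s =>
    (Finset.univ.filter (fun i : Fin n =>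
      ((i.1 + 1 : ℝ) / n, ((π i).1 + 1 : ℝ) / n) ∈ Trs k r s)).card

open scoped Classical in
/-- `M_r = #{i : i/n ∈ I_r}`, the `r`-th block size. -/
def Mrow (k n : ℕ) (r : Fin k) : ℕ :=
  (Finset.univ.filter (fun i : Fin n => ((i.1 + 1 : ℝ) / n) ∈ Ik k r)).card

/-- `𝓜_{k,n}`: nonnegative integer `k×k` matrices with `r`-th row sum and `r`-th column
sum both equal to `M_r`. -/
def Mkn (k n : ℕ) : Set (Matrix (Fin k) (Fin k) ℕ) :=
  {M | (∀ r, ∑ s, M r s = Mrow k n r) ∧ (∀ s, ∑ r, M r s = Mrow k n s)}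

/-- `𝓜_k`: `k×k` matrices with nonnegative real entries and all row and column sums
equal to `1/k`. -/
def Mk (k : ℕ) : Set (Matrix (Fin k) (Fin k) ℝ) :=
  {A | (∀ r s, 0 ≤ A r s) ∧ (∀ r, ∑ s, A r s = 1 / k) ∧ (∀ s, ∑ r, A r s = 1 / k)}

/-- `D_k(A) = ∑_{r,s} A(r,s) log(k² A(r,s))` (with `0 log 0 = 0`). -/
def Dk (k : ℕ) (A : Matrix (Fin k) (Fin k) ℝ) : ℝ :=
  ∑ r, ∑ s, A r s * Real.log ((k : ℝ) ^ 2 * A r s)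

/-- `V[k,μ₀](ε) = {A ∈ 𝓜_k : max_{r,s} |A(r,s) − μ₀(T_{rs})| < ε}`. -/
def Vset (k : ℕ) (μ₀ : Measure (ℝ × ℝ)) (ε : ℝ) : Set (Matrix (Fin k) (Fin k) ℝ) :=
  {A | A ∈ Mk k ∧ ∀ r s, |A r s - (μ₀ (Trs k r s)).toReal| < ε}

/-- `V_n[k,μ₀](ε) = {M ∈ 𝓜_{k,n} : max_{r,s} |M_{rs}/n − μ₀(T_{rs})| < ε}`. -/
def Vnset (k n : ℕ) (μ₀ : Measure (ℝ × ℝ)) (ε : ℝ) : Set (Matrix (Fin k) (Fin k) ℕ) :=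
  {M | M ∈ Mkn k n ∧ ∀ r s, |(M r s : ℝ) / n - (μ₀ (Trs k r s)).toReal| < ε}

/-! ### Permutations with prescribed block counts -/

section Counting

variable {α β : Type*} [Fintype α] [DecidableEq β]

theorem exists_perm_comp_eq (u v : α → β)
    (h : ∀ b, (Finset.univ.filter fun a => u a = b).card =
      (Finset.univ.filter fun a => v a = b).card) :
    ∃ σ : Equiv.Perm α, u ∘ σ = v := by
  have e : ∀ b, Nonempty ({a // v a = b} ≃ {a // u a = b}) := fun b => by
    rw [← Fintype.card_eq, Fintype.card_subtype, Fintype.card_subtype, h b]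
  refine ⟨(Equiv.sigmaFiberEquiv v).symm.trans
    ((Equiv.sigmaCongrRight fun b => (e b).some).trans (Equiv.sigmaFiberEquiv u)), ?_⟩
  funext a
  exact ((e (v a)).some ⟨a, rfl⟩).2

theorem card_perm_comp_eq [DecidableEq α] [Fintype β] (u v : α → β)
    (h : ∀ b, (Finset.univ.filter fun a => u a = b).card =
      (Finset.univ.filter fun a => v a = b).card) :
    (Finset.univ.filter fun σ : Equiv.Perm α => u ∘ σ = v).card =
      ∏ b, ((Finset.univ.filter fun a => u a = b).card).factorial := by
  obtain ⟨τ, rfl⟩ := exists_perm_comp_eq u v h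
  have key := DomMulAct.stabilizer_card u
  simp only [Fintype.card_subtype] at key
  rw [← key]
  refine Finset.card_bij (fun σ _ => σ * τ⁻¹) ?_ ?_ ?_
  · intro σ hσ
    simp only [Finset.mem_filter, Finset.mem_univ, true_and] at hσ ⊢
    rw [Equiv.Perm.coe_mul, ← Function.comp_assoc, hσ, Function.comp_assoc,
      ← Equiv.Perm.coe_mul, mul_inv_cancel, Equiv.Perm.coe_one, Function.comp_id]
  · intro a _ b _ hab
    exact mul_right_cancel hab
  · intro σ hσ
    simp only [Finset.mem_filter, Finset.mem_univ, true_and] at hσ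
    refine ⟨σ * τ, ?_, by simp⟩
    simp only [Finset.mem_filter, Finset.mem_univ, true_and]
    rw [Equiv.Perm.coe_mul, ← Function.comp_assoc, hσ]

/-- The number of points of each type `(r, s)`, where the type of `a` is `(f a, f (π a))`. -/
def blockCount (f : α → β) (π : Equiv.Perm α) (r s : β) : ℕ :=
  (Finset.univ.filter fun a => f a = r ∧ f (π a) = s).card

theorem blockCount_eq_card_pair (f : α → β) (π : Equiv.Perm α) (p : β × β) :
    blockCount f π p.1 p.2 = (Finset.univ.filter fun a => (f a, f (π a)) = p).card := by
  simp only [blockCount, Prod.ext_iff]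

theorem sum_blockCount_right [Fintype β] (f : α → β) (π : Equiv.Perm α) (r : β) :
    ∑ s, blockCount f π r s = (Finset.univ.filter fun a => f a = r).card := by
  rw [Finset.card_eq_sum_card_fiberwise (f := fun a => f (π a)) (t := Finset.univ)
    (fun _ _ => by simp)]
  simp only [blockCount, Finset.filter_filter]

theorem card_filter_perm_comp (f : α → β) (π : Equiv.Perm α) (s : β) :
    (Finset.univ.filter fun a => f (π a) = s).card =
      (Finset.univ.filter fun a => f a = s).card :=
  Finset.card_bij (fun a _ => π a) (by simp) (by simp)
    (fun b hb => ⟨π.symm b, by simpa using hb, by simp⟩)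

theorem sum_blockCount_left [Fintype β] (f : α → β) (π : Equiv.Perm α) (s : β) :
    ∑ r, blockCount f π r s = (Finset.univ.filter fun a => f a = s).card := by
  rw [← card_filter_perm_comp f π, Finset.card_eq_sum_card_fiberwise (f := f)
    (t := Finset.univ) (fun _ _ => by simp)]
  simp only [blockCount, Finset.filter_filter, and_comm]

/-- Composing with permutations preserving `f` on both sides keeps the block counts. -/
theorem blockCount_mul_mul_inv (f : α → β) (π a b : Equiv.Perm α) (ha : f ∘ a = f)
    (hb : f ∘ b = f) : blockCount f (a * π * b⁻¹) = blockCount f π := by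
  funext r s
  have ha' : ∀ x, f (a x) = f x := congrFun ha
  have hb' : ∀ x, f (b x) = f x := congrFun hb
  refine (Finset.card_bij (fun x _ => b x) ?_ (by simp) ?_).symm
  · intro x hx
    simpa [ha', hb'] using hx
  · intro x hx
    refine ⟨b⁻¹ x, ?_, by simp⟩
    have hx' : f (b⁻¹ x) = f x := by rw [← hb' (b⁻¹ x)]; simp
    have hx₁ : f x = r ∧ f (π (b⁻¹ x)) = s := by simpa [ha'] using hx
    rw [Finset.mem_filter, hx']
    exact ⟨Finset.mem_univ _, hx₁⟩

theorem card_blockCount_eq_mul_prod_factorial [DecidableEq α] [Fintype β] (f : α → β)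
    (π₀ : Equiv.Perm α) :
    (Finset.univ.filter fun π : Equiv.Perm α => blockCount f π = blockCount f π₀).card *
      ∏ r, ∏ s, (blockCount f π₀ r s).factorial =
    (∏ r, ((Finset.univ.filter fun a => f a = r).card).factorial) ^ 2 := by
  set H : Finset (Equiv.Perm α) := Finset.univ.filter fun σ => f ∘ σ = f with hH
  have hHcard : H.card = ∏ r, ((Finset.univ.filter fun a => f a = r).card).factorial :=
    card_perm_comp_eq f f fun _ => rfl
  rw [← hHcard, sq, ← Finset.card_product,
    Finset.card_eq_sum_card_fiberwise (f := fun p : Equiv.Perm α × Equiv.Perm α => p.1 * π₀ * p.2⁻¹)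
      (t := Finset.univ.filter fun π : Equiv.Perm α => blockCount f π = blockCount f π₀)]
  · symm
    refine Finset.sum_const_nat ?_
    intro π hπ
    simp only [Finset.mem_filter, Finset.mem_univ, true_and] at hπ
    have hfib : ∀ p : β × β, (Finset.univ.filter fun a => (f a, f (π a)) = p).card =
        (Finset.univ.filter fun a => (f a, f (π₀ a)) = p).card := fun p => by
      rw [← blockCount_eq_card_pair, ← blockCount_eq_card_pair, hπ]
    have hcount : (Finset.univ.filter fun σ : Equiv.Perm α =>
        (fun a => (f a, f (π a))) ∘ σ = fun a => (f a, f (π₀ a))).card =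
        ∏ p : β × β, (blockCount f π₀ p.1 p.2).factorial := by
      have h := card_perm_comp_eq (fun a => (f a, f (π a))) (fun a => (f a, f (π₀ a)))
        fun p => by convert hfib p
      refine (Eq.trans (by congr!) h).trans ?_
      refine Finset.prod_congr rfl fun p _ => ?_
      rw [blockCount_eq_card_pair, ← hfib p]
    rw [Fintype.prod_prod_type] at hcount
    rw [← hcount]
    refine Finset.card_bij (fun p _ => p.2) ?_ ?_ ?_
    · rintro ⟨a, b⟩ hab
      simp only [Finset.mem_filter, Finset.mem_product, hH, Finset.mem_univ, true_and] at hab ⊢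
      obtain ⟨⟨ha, hb⟩, rfl⟩ := hab
      funext x
      have h1 := congrFun ha (π₀ x)
      have h2 := congrFun hb x
      simp_all
    · rintro ⟨a, b⟩ hab ⟨a', b'⟩ hab' h
      simp only [Finset.mem_filter, Finset.mem_product] at hab hab' h
      subst h
      have h3 := mul_right_cancel (mul_right_cancel (hab.2.trans hab'.2.symm))
      rw [h3]
    · intro b hb
      simp only [Finset.mem_filter, Finset.mem_univ, true_and] at hb
      have hb1 : ∀ x, f (b x) = f x := fun x => (Prod.ext_iff.1 (congrFun hb x)).1
      have hb2 : ∀ x, f (π (b x)) = f (π₀ x) := fun x => (Prod.ext_iff.1 (congrFun hb x)).2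
      refine ⟨(π * b * π₀⁻¹, b), ?_, rfl⟩
      simp only [Finset.mem_filter, Finset.mem_product, hH, Finset.mem_univ, true_and]
      refine ⟨⟨?_, funext hb1⟩, by group⟩
      funext x
      simp [hb2]
  · rintro ⟨a, b⟩ hab
    simp only [hH, Finset.coe_product, Set.mem_prod, Finset.mem_coe, Finset.mem_filter,
      Finset.mem_univ, true_and] at hab ⊢
    exact blockCount_mul_mul_inv f π₀ a b hab.1 hab.2

theorem exists_fiber_card_eq [Fintype β] (c : β → ℕ) (hc : ∑ b, c b = Fintype.card α) :
    ∃ w : α → β, ∀ b, (Finset.univ.filter fun a => w a = b).card = c b := by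
  have e : Nonempty (α ≃ Σ b, Fin (c b)) := by
    rw [← Fintype.card_eq]
    simp [hc]
  refine ⟨fun a => (e.some a).1, fun b => ?_⟩
  rw [← Fintype.card_subtype, Fintype.card_congr
    ((e.some.subtypeEquiv fun _ => Iff.rfl).trans (Equiv.sigmaSubtype b)), Fintype.card_fin]

/-- Every nonnegative integer matrix with the right margins is a matrix of block counts. -/
theorem exists_perm_blockCount_eq [Fintype β] (f : α → β) (M : β → β → ℕ)
    (hrow : ∀ r, ∑ s, M r s = (Finset.univ.filter fun a => f a = r).card)
    (hcol : ∀ s, ∑ r, M r s = (Finset.univ.filter fun a => f a = s).card) :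
    ∃ π : Equiv.Perm α, blockCount f π = M := by
  obtain ⟨w, hw⟩ := exists_fiber_card_eq (α := α) (fun p : β × β => M p.1 p.2) (by
    rw [Fintype.sum_prod_type]
    simp only [hrow]
    rw [← Finset.card_univ, Finset.card_eq_sum_card_fiberwise (f := f) (t := Finset.univ)
      (fun _ _ => by simp)])
  have h1 : ∀ r, (Finset.univ.filter fun a => (w a).1 = r).card =
      (Finset.univ.filter fun a => f a = r).card := fun r => by
    rw [← hrow, Finset.card_eq_sum_card_fiberwise (f := fun a => (w a).2) (t := Finset.univ)
      (fun _ _ => by simp)]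
    refine Finset.sum_congr rfl fun s _ => ?_
    rw [← hw (r, s), Finset.filter_filter]
    simp only [Prod.ext_iff]
  have h2 : ∀ s, (Finset.univ.filter fun a => (w a).2 = s).card =
      (Finset.univ.filter fun a => f a = s).card := fun s => by
    rw [← hcol, Finset.card_eq_sum_card_fiberwise (f := fun a => (w a).1) (t := Finset.univ)
      (fun _ _ => by simp)]
    refine Finset.sum_congr rfl fun r _ => ?_
    rw [← hw (r, s), Finset.filter_filter]
    simp only [Prod.ext_iff, and_comm]
  obtain ⟨σ, hσ⟩ := exists_perm_comp_eq (fun a => (w a).1) f h1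
  obtain ⟨π, hπ⟩ := exists_perm_comp_eq f (fun a => (w (σ a)).2) fun s => by
    rw [← h2, card_filter_perm_comp (fun a => (w a).2) σ]
  have hσ' : ∀ a, (w (σ a)).1 = f a := congrFun hσ
  have hπ' : ∀ a, f (π a) = (w (σ a)).2 := congrFun hπ
  refine ⟨π, ?_⟩
  funext r s
  rw [← hw (r, s), ← card_filter_perm_comp w σ, blockCount]
  simp only [Prod.ext_iff, hσ', hπ']

end Counting

/-! ### Factorial estimates -/

/-- The error in the approximation `log m! ≈ m log m - m`. -/
def logFactorialError (m : ℕ) : ℝ :=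
  Real.log (m.factorial : ℝ) - ((m : ℝ) * Real.log m - m)

theorem logFactorialError_nonneg (m : ℕ) : 0 ≤ logFactorialError m := by
  rcases Nat.eq_zero_or_pos m with rfl | hm
  · simp [logFactorialError]
  have hm' : (0 : ℝ) < m := by exact_mod_cast hm
  have hf : (0 : ℝ) < m.factorial := by exact_mod_cast m.factorial_pos
  have h := Real.log_le_log (by positivity) (Real.pow_div_factorial_le_exp _ hm'.le m)
  rw [Real.log_exp, Real.log_div (by positivity) hf.ne', Real.log_pow] at h
  unfold logFactorialError
  linarith

theorem logFactorialError_succ_le (m : ℕ) :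
    logFactorialError (m + 1) ≤ 1 + Real.log (m + 1 : ℕ) := by
  induction m with
  | zero => simp [logFactorialError]
  | succ m ih =>
    unfold logFactorialError at ih ⊢
    rw [Nat.factorial_succ, Nat.cast_mul, Real.log_mul (by positivity) (by positivity)]
    have hx : (0 : ℝ) < (m + 1 : ℕ) := by positivity
    have hy : ((m + 1 + 1 : ℕ) : ℝ) = (m + 1 : ℕ) + 1 := by push_cast; ring
    rw [hy]
    set x : ℝ := ((m + 1 : ℕ) : ℝ)
    have h := Real.one_sub_inv_le_log_of_pos (show 0 < (x + 1) / x by positivity)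
    rw [Real.log_div (by positivity) hx.ne'] at h
    have h' : (x + 1) * (1 - ((x + 1) / x)⁻¹) = 1 := by field_simp; ring
    have h2 := mul_le_mul_of_nonneg_left h (show 0 ≤ x + 1 by positivity)
    rw [h'] at h2
    nlinarith

theorem logFactorialError_le {m n : ℕ} (h : m ≤ n) :
    logFactorialError m ≤ 1 + Real.log (n + 1) := by
  cases m with
  | zero =>
    have : 0 ≤ Real.log ((n : ℝ) + 1) := Real.log_nonneg (by linarith [n.cast_nonneg (α := ℝ)])
    simp [logFactorialError]
    linarith
  | succ m =>
    refine (logFactorialError_succ_le m).trans ?_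
    have : Real.log (m + 1 : ℕ) ≤ Real.log ((n : ℝ) + 1) :=
      Real.log_le_log (by positivity) (by
        have : ((m + 1 : ℕ) : ℝ) ≤ n := by exact_mod_cast h
        linarith)
    linarith

/-! ### Blocks -/

section Blocks

variable {k n : ℕ}

/-- The index of the block `I_r` containing `(i + 1) / n`. -/
def blockIndex (hk : 0 < k) (n : ℕ) (i : Fin n) : Fin k :=
  ⟨((i.1 + 1) * k - 1) / n, by
    have h1 : (i.1 + 1) * k ≤ n * k := Nat.mul_le_mul_right k i.2
    have h2 : 0 < (i.1 + 1) * k := by positivity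
    exact Nat.div_lt_of_lt_mul (by omega)⟩

theorem blockIndex_eq_iff (hk : 0 < k) (i : Fin n) (r : Fin k) :
    blockIndex hk n i = r ↔ n * r.1 < (i.1 + 1) * k ∧ (i.1 + 1) * k ≤ n * (r.1 + 1) := by
  have hn : 0 < n := i.pos
  have h2 : 0 < (i.1 + 1) * k := by positivity
  rw [blockIndex, Fin.ext_iff, Nat.div_eq_iff hn]
  simp only [mul_comm r.1 n, mul_add, mul_one]
  omega

theorem mem_Ik_iff_blockIndex_eq (hk : 0 < k) (i : Fin n) (r : Fin k) :
    ((i.1 + 1 : ℝ) / n) ∈ Ik k r ↔ blockIndex hk n i = r := by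
  have hn : (0 : ℝ) < n := by exact_mod_cast i.pos
  have hk' : (0 : ℝ) < k := by exact_mod_cast hk
  have key : blockIndex hk n i = r ↔
      ((n : ℝ) * r.1 < (i.1 + 1) * k ∧ ((i.1 : ℝ) + 1) * k ≤ n * (r.1 + 1)) := by
    rw [blockIndex_eq_iff]
    exact_mod_cast Iff.rfl
  rw [key, Ik]
  split_ifs with h
  · rw [Set.mem_Icc, div_le_div_iff₀ hn hk', h]
    simp only [Nat.cast_zero, mul_zero, zero_add, mul_one, one_mul]
    refine and_congr ⟨fun _ => by positivity, fun _ => by positivity⟩ Iff.rfl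
  · rw [Set.mem_Ioc, div_lt_div_iff₀ hk' hn, div_le_div_iff₀ hn hk', mul_comm (r.1 : ℝ),
      mul_comm ((r.1 : ℝ) + 1)]

theorem Mmat_eq_blockCount (hk : 0 < k) (π : Equiv.Perm (Fin n)) :
    Mmat k n π = blockCount (blockIndex hk n) π := by
  funext r s
  simp only [Mmat, Matrix.of_apply, blockCount, Trs, Set.mem_prod, mem_Ik_iff_blockIndex_eq hk]

theorem Mrow_eq_card (hk : 0 < k) (r : Fin k) :
    Mrow k n r = (Finset.univ.filter fun i => blockIndex hk n i = r).card := by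
  simp only [Mrow, mem_Ik_iff_blockIndex_eq hk]

theorem sum_Mrow (hk : 0 < k) (n : ℕ) : ∑ r, Mrow k n r = n := by
  simp only [Mrow_eq_card hk]
  rw [← Finset.card_eq_sum_card_fiberwise (f := blockIndex hk n) (s := Finset.univ)
    (fun _ _ => by simp)]
  simp

theorem Mmat_mem_Mkn (hk : 0 < k) (π : Equiv.Perm (Fin n)) : Mmat k n π ∈ Mkn k n := by
  rw [Mmat_eq_blockCount hk]
  exact ⟨fun r => by rw [Mrow_eq_card hk, sum_blockCount_right],
    fun s => by rw [Mrow_eq_card hk, sum_blockCount_left]⟩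

theorem exists_Mmat_eq (hk : 0 < k) {M : Matrix (Fin k) (Fin k) ℕ} (hM : M ∈ Mkn k n) :
    ∃ π : Equiv.Perm (Fin n), Mmat k n π = M := by
  obtain ⟨π, hπ⟩ := exists_perm_blockCount_eq (blockIndex hk n) M
    (fun r => (hM.1 r).trans (Mrow_eq_card hk r)) (fun s => (hM.2 s).trans (Mrow_eq_card hk s))
  exact ⟨π, by rw [Mmat_eq_blockCount hk, hπ]⟩

open scoped Classical in
theorem card_Mmat_eq_mul_prod_factorial (hk : 0 < k) {M : Matrix (Fin k) (Fin k) ℕ}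
    (hM : M ∈ Mkn k n) :
    (Finset.univ.filter fun π : Equiv.Perm (Fin n) => Mmat k n π = M).card *
      ∏ r, ∏ s, (M r s).factorial = (∏ r, (Mrow k n r).factorial) ^ 2 := by
  obtain ⟨π₀, rfl⟩ := exists_Mmat_eq hk hM
  simp only [Mrow_eq_card hk, Mmat_eq_blockCount hk]
  rw [← card_blockCount_eq_mul_prod_factorial (blockIndex hk n) π₀]
  congr!

theorem Mrow_eq_sub (hk : 0 < k) (r : Fin k) :
    Mrow k n r = n * (r.1 + 1) / k - n * r.1 / k := by
  rw [Mrow_eq_card hk, ← Nat.card_Ioc]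
  refine Finset.card_bij (fun i _ => i.1 + 1) ?_ ?_ ?_
  · intro i hi
    simp only [Finset.mem_filter, Finset.mem_univ, true_and, blockIndex_eq_iff] at hi
    rw [Finset.mem_Ioc, Nat.div_lt_iff_lt_mul hk, Nat.le_div_iff_mul_le hk]
    exact hi
  · intro i _ j _ h
    ext
    simpa using h
  · intro m hm
    rw [Finset.mem_Ioc, Nat.div_lt_iff_lt_mul hk, Nat.le_div_iff_mul_le hk] at hm
    have hm0 : 0 < m := by
      rcases Nat.eq_zero_or_pos m with rfl | h
      · simp at hm
      · exact h
    have hmn : m ≤ n :=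
      Nat.le_of_mul_le_mul_right (hm.2.trans (Nat.mul_le_mul_left n r.2)) hk
    refine ⟨⟨m - 1, by omega⟩, ?_, by simp; omega⟩
    simp only [Finset.mem_filter, Finset.mem_univ, true_and, blockIndex_eq_iff]
    rwa [Nat.sub_add_cancel hm0]

theorem div_le_Mrow (hk : 0 < k) (r : Fin k) : n / k ≤ Mrow k n r := by
  rw [Mrow_eq_sub hk, mul_add, mul_one]
  have : n * r.1 / k + n / k ≤ (n * r.1 + n) / k := Nat.div_add_div_le_add_div
  omega

theorem Mrow_le (hk : 0 < k) (r : Fin k) : Mrow k n r ≤ n :=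
  (Finset.single_le_sum (f := Mrow k n) (fun _ _ => Nat.zero_le _) (Finset.mem_univ r)).trans_eq
    (sum_Mrow hk n)

theorem entry_le_of_mem_Mkn (hk : 0 < k) {M : Matrix (Fin k) (Fin k) ℕ} (hM : M ∈ Mkn k n)
    (r s : Fin k) : M r s ≤ n :=
  (Finset.single_le_sum (f := M r) (fun _ _ => Nat.zero_le _) (Finset.mem_univ s)).trans
    ((hM.1 r).trans_le (Mrow_le hk r))

theorem abs_Mrow_sub_le (hk : 0 < k) (r : Fin k) : |(Mrow k n r : ℝ) - n / k| ≤ 1 := by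
  have hk' : (0 : ℝ) < k := by exact_mod_cast hk
  have hle : n * r.1 / k ≤ n * (r.1 + 1) / k :=
    Nat.div_le_div_right (Nat.mul_le_mul_left n (Nat.le_succ _))
  rw [Mrow_eq_sub hk, Nat.cast_sub hle]
  have a1 : ((n * r.1 / k : ℕ) : ℝ) * k ≤ n * r.1 := by
    exact_mod_cast Nat.div_mul_le_self (n * r.1) k
  have a2 : (n : ℝ) * r.1 < ((n * r.1 / k : ℕ) + 1) * k := by
    exact_mod_cast Nat.lt_mul_of_div_lt (Nat.lt_succ_self (n * r.1 / k)) hk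
  have b1 : ((n * (r.1 + 1) / k : ℕ) : ℝ) * k ≤ n * (r.1 + 1) := by
    exact_mod_cast Nat.div_mul_le_self (n * (r.1 + 1)) k
  have b2 : (n : ℝ) * (r.1 + 1) < ((n * (r.1 + 1) / k : ℕ) + 1) * k := by
    exact_mod_cast Nat.lt_mul_of_div_lt (Nat.lt_succ_self (n * (r.1 + 1) / k)) hk
  have e : (n : ℝ) / k * k = n := by field_simp
  rw [abs_le]
  constructor
  · refine le_of_mul_le_mul_right ?_ hk'
    nlinarith
  · refine le_of_mul_le_mul_right ?_ hk'
    nlinarith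

theorem tendsto_Mrow_div (hk : 0 < k) (r : Fin k) :
    Tendsto (fun n : ℕ => (Mrow k n r : ℝ) / n) atTop (𝓝 (1 / k)) := by
  rw [tendsto_iff_norm_sub_tendsto_zero]
  refine squeeze_zero' (Eventually.of_forall fun _ => norm_nonneg _) ?_
    (tendsto_one_div_atTop_nhds_zero_nat (𝕜 := ℝ))
  filter_upwards [eventually_gt_atTop 0] with n hn
  have hn' : (0 : ℝ) < n := by exact_mod_cast hn
  have e : (Mrow k n r : ℝ) / n - 1 / k = ((Mrow k n r : ℝ) - n / k) / n := by field_simp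
  rw [e, Real.norm_eq_abs, abs_div, abs_of_pos hn']
  exact div_le_div_of_nonneg_right (abs_Mrow_sub_le hk r) hn'.le

/-- By Birkhoff's theorem, every matrix in `𝓜_k` is a limit of rescaled integer matrices with
the exact margins. -/
theorem exists_mem_Mkn_tendsto (hk : 0 < k) {A : Matrix (Fin k) (Fin k) ℝ} (hA : A ∈ Mk k) :
    ∃ M : ℕ → Matrix (Fin k) (Fin k) ℕ, (∀ n, M n ∈ Mkn k n) ∧
      ∀ r s, Tendsto (fun n : ℕ => (M n r s : ℝ) / n) atTop (𝓝 (A r s)) := by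
  have hk' : (0 : ℝ) < k := by exact_mod_cast hk
  have hDS : (k : ℝ) • A ∈ doublyStochastic ℝ (Fin k) := by
    rw [mem_doublyStochastic_iff_sum]
    refine ⟨fun i j => ?_, fun i => ?_, fun j => ?_⟩
    · exact mul_nonneg hk'.le (hA.1 i j)
    · simp only [Matrix.smul_apply, smul_eq_mul, ← Finset.mul_sum, hA.2.1]
      field_simp
    · simp only [Matrix.smul_apply, smul_eq_mul, ← Finset.mul_sum, hA.2.2]
      field_simp
  obtain ⟨w, hw0, hw1, hwA⟩ := exists_eq_sum_perm_of_mem_doublyStochastic hDS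
  have hA' : ∀ r s, A r s = ∑ σ : Equiv.Perm (Fin k), if σ r = s then w σ / k else 0 := by
    intro r s
    have h := congrFun (congrFun hwA r) s
    simp only [Matrix.sum_apply, Matrix.smul_apply, smul_eq_mul, Equiv.Perm.permMatrix,
      PEquiv.toMatrix_apply, Equiv.toPEquiv_apply, Option.mem_some_iff, mul_ite, mul_one,
      mul_zero] at h
    rw [eq_comm, ← mul_right_inj' hk'.ne', ← h, Finset.mul_sum]
    refine Finset.sum_congr rfl fun σ _ => ?_
    split_ifs
    · field_simp
    · simp
  set a : Equiv.Perm (Fin k) → ℕ → ℕ := fun σ n => ⌊w σ / k * n⌋₊ with ha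
  have ha_lim : ∀ σ, Tendsto (fun n : ℕ => (a σ n : ℝ) / n) atTop (𝓝 (w σ / k)) := fun σ =>
    (tendsto_nat_floor_mul_div_atTop (div_nonneg (hw0 σ) hk'.le)).comp
      tendsto_natCast_atTop_atTop
  have hS : ∀ n, ∑ σ, a σ n ≤ n / k := fun n => by
    rw [Nat.le_div_iff_mul_le hk, ← Nat.cast_le (α := ℝ)]
    push_cast
    have h : ∑ σ, (a σ n : ℝ) ≤ ∑ σ, w σ / k * n := Finset.sum_le_sum fun σ _ =>
      Nat.floor_le (mul_nonneg (div_nonneg (hw0 σ) hk'.le) n.cast_nonneg)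
    rw [← Finset.sum_mul, ← Finset.sum_div, hw1] at h
    calc (∑ σ, (a σ n : ℝ)) * k ≤ (1 / k * n) * k := mul_le_mul_of_nonneg_right h hk'.le
      _ = n := by field_simp
  have hSM : ∀ n r, ∑ σ, a σ n ≤ Mrow k n r := fun n r => (hS n).trans (div_le_Mrow hk r)
  refine ⟨fun n => Matrix.of fun r s => (∑ σ : Equiv.Perm (Fin k), if σ r = s then a σ n else 0) +
    if r = s then Mrow k n r - ∑ σ, a σ n else 0, fun n => ⟨fun r => ?_, fun s => ?_⟩,
    fun r s => ?_⟩
  · simp only [Matrix.of_apply]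
    rw [Finset.sum_add_distrib, Finset.sum_comm]
    simp [Nat.add_sub_cancel' (hSM n r)]
  · simp only [Matrix.of_apply]
    rw [Finset.sum_add_distrib, Finset.sum_comm]
    simp [← Equiv.eq_symm_apply, Nat.add_sub_cancel' (hSM n s)]
  · have hdiag : Tendsto (fun n : ℕ => ((if r = s then Mrow k n r - ∑ σ, a σ n else 0 : ℕ) : ℝ) / n)
        atTop (𝓝 0) := by
      split_ifs with h
      · have h1 := (tendsto_Mrow_div hk r).sub (tendsto_finsetSum Finset.univ fun σ _ => ha_lim σ)
        rw [← Finset.sum_div, hw1, sub_self] at h1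
        refine h1.congr fun n => ?_
        rw [Nat.cast_sub (hSM n r), Nat.cast_sum, sub_div, Finset.sum_div]
      · simp
    have hmain : Tendsto (fun n : ℕ => ((∑ σ : Equiv.Perm (Fin k),
        if σ r = s then a σ n else 0 : ℕ) : ℝ) / n) atTop (𝓝 (A r s)) := by
      rw [hA' r s]
      simp only [Nat.cast_sum, Finset.sum_div]
      refine tendsto_finsetSum Finset.univ fun σ _ => ?_
      split_ifs with h
      · exact ha_lim σ
      · simp
    have h := hmain.add hdiag
    rw [add_zero] at h
    refine h.congr fun n => ?_
    simp only [Matrix.of_apply]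
    rw [Nat.cast_add, add_div]

end Blocks

/-! ### The block matrix of a permuton -/

section BlockMatrix

variable {k : ℕ}

theorem measurableSet_Ik (r : Fin k) : MeasurableSet (Ik k r) := by
  unfold Ik
  split_ifs
  · exact measurableSet_Icc
  · exact measurableSet_Ioc

theorem mem_Ik_iff (hk : 0 < k) {x : ℝ} (hx : 0 ≤ x) (r : Fin k) :
    x ∈ Ik k r ↔ ⌈x * k⌉₊ - 1 = r.1 := by
  have hk' : (0 : ℝ) < k := by exact_mod_cast hk
  unfold Ik
  split_ifs with h
  · rw [h, Set.mem_Icc, le_div_iff₀ hk', Nat.sub_eq_zero_iff_le, Nat.ceil_le]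
    simp [hx]
  · have : ⌈x * k⌉₊ - 1 = r.1 ↔ r.1 < ⌈x * k⌉₊ ∧ ⌈x * k⌉₊ ≤ r.1 + 1 := by omega
    rw [this, Set.mem_Ioc, div_lt_iff₀ hk', le_div_iff₀ hk', Nat.lt_ceil, Nat.ceil_le]
    push_cast
    rfl

theorem Ik_subset_Icc (hk : 0 < k) (r : Fin k) : Ik k r ⊆ Set.Icc 0 1 := by
  have hk' : (0 : ℝ) < k := by exact_mod_cast hk
  have h1 : ((r.1 : ℝ) + 1) / k ≤ 1 := by
    rw [div_le_one hk']
    exact_mod_cast r.2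
  unfold Ik
  split_ifs with h
  · refine Set.Icc_subset_Icc le_rfl ?_
    simpa [h] using h1
  · exact fun x hx => ⟨le_trans (by positivity) hx.1.le, hx.2.trans h1⟩

theorem pairwise_disjoint_Ik (hk : 0 < k) :
    Pairwise (Function.onFun Disjoint (Ik k)) := by
  intro r s hrs
  refine Set.disjoint_left.2 fun x hr hs => hrs ?_
  have hx := (Ik_subset_Icc hk r hr).1
  exact Fin.ext (((mem_Ik_iff hk hx r).1 hr).symm.trans ((mem_Ik_iff hk hx s).1 hs))

theorem iUnion_Ik (hk : 0 < k) : ⋃ r, Ik k r = Set.Icc 0 1 := by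
  refine Set.Subset.antisymm (Set.iUnion_subset (Ik_subset_Icc hk)) fun x hx => ?_
  have hlt : ⌈x * k⌉₊ - 1 < k := by
    have : ⌈x * k⌉₊ ≤ k := Nat.ceil_le.2 (mul_le_of_le_one_left k.cast_nonneg hx.2)
    omega
  exact Set.mem_iUnion.2 ⟨⟨_, hlt⟩, (mem_Ik_iff hk hx.1 _).2 rfl⟩

theorem unif01_Ik (hk : 0 < k) (r : Fin k) : unif01 (Ik k r) = ENNReal.ofReal (1 / k) := by
  rw [unif01, Measure.restrict_apply (measurableSet_Ik r),
    Set.inter_eq_self_of_subset_left (Ik_subset_Icc hk r)]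
  unfold Ik
  split_ifs
  · simp
  · rw [Real.volume_Ioc]
    congr 1
    ring

theorem blockMatrix_mem_Mk (hk : 0 < k) {μ₀ : Measure (ℝ × ℝ)} (hμ₀ : μ₀ ∈ MM) :
    (fun r s => (μ₀ (Trs k r s)).toReal) ∈ Mk k := by
  obtain ⟨hprob, hfst, hsnd⟩ := hμ₀
  have hcompl : unif01 (Set.Icc 0 1)ᶜ = 0 := by
    rw [unif01, Measure.restrict_apply measurableSet_Icc.compl]
    simp
  have key : ∀ (S : Set (ℝ × ℝ)) (p : ℝ × ℝ → ℝ), Measurable p → MeasurableSet S →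
      μ₀.map p = unif01 → μ₀ S = ∑ s : Fin k, μ₀ (S ∩ p ⁻¹' Ik k s) := by
    intro S p hp hS hmap
    rw [← tsum_fintype (L := SummationFilter.unconditional _),
      ← measure_iUnion _ fun s => hS.inter (hp (measurableSet_Ik s)),
      ← Set.inter_iUnion, ← Set.preimage_iUnion, iUnion_Ik hk]
    · refine (measure_inter_conull ?_).symm
      rw [← Set.preimage_compl, ← Measure.map_apply hp measurableSet_Icc.compl, hmap, hcompl]
    · intro r s hrs
      exact ((pairwise_disjoint_Ik hk hrs).preimage p).mono Set.inter_subset_right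
        Set.inter_subset_right
  have hreal : (ENNReal.ofReal (1 / (k : ℝ))).toReal = 1 / k :=
    ENNReal.toReal_ofReal (by positivity)
  refine ⟨fun r s => ENNReal.toReal_nonneg, fun r => ?_, fun s => ?_⟩
  · have h := key (Prod.fst ⁻¹' Ik k r) Prod.snd measurable_snd
      (measurable_fst (measurableSet_Ik r)) hsnd
    rw [← Measure.map_apply measurable_fst (measurableSet_Ik r), hfst, unif01_Ik hk] at h
    rw [← hreal, h, ENNReal.toReal_sum fun _ _ => measure_ne_top _ _]
    rfl
  · have h := key (Prod.snd ⁻¹' Ik k s) Prod.fst measurable_fst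
      (measurable_snd (measurableSet_Ik s)) hfst
    rw [← Measure.map_apply measurable_snd (measurableSet_Ik s), hsnd, unif01_Ik hk] at h
    rw [← hreal, h, ENNReal.toReal_sum fun _ _ => measure_ne_top _ _]
    simp only [Trs, Set.prod_eq, Set.inter_comm]

end BlockMatrix

/-! ### Entropy asymptotics -/

section Entropy

variable {k n : ℕ}

/-- The sum of `B(r,s) log B(r,s)`. -/
def sumMulLog (B : Fin k → Fin k → ℝ) : ℝ := ∑ r, ∑ s, B r s * Real.log (B r s)

theorem continuous_sumMulLog : Continuous (sumMulLog (k := k)) := by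
  unfold sumMulLog
  refine continuous_finsetSum _ fun r _ => continuous_finsetSum _ fun s _ => ?_
  exact Real.continuous_mul_log.comp (continuous_apply_apply r s)

theorem Dk_eq_of_mem_Mk (hk : 0 < k) {A : Matrix (Fin k) (Fin k) ℝ} (hA : A ∈ Mk k) :
    Dk k A = sumMulLog A + 2 * Real.log k := by
  have hk' : (0 : ℝ) < k := by exact_mod_cast hk
  have hterm : ∀ r s, A r s * Real.log ((k : ℝ) ^ 2 * A r s) =
      A r s * Real.log (A r s) + A r s * (2 * Real.log k) := fun r s => by
    rcases eq_or_ne (A r s) 0 with h | h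
    · simp [h]
    · rw [Real.log_mul (by positivity) h, Real.log_pow]
      push_cast
      ring
  simp only [Dk, sumMulLog, hterm, Finset.sum_add_distrib, ← Finset.sum_mul, hA.2.1]
  simp [hk'.ne']

theorem bddBelow_Dk_image (hk : 0 < k) (μ₀ : Measure (ℝ × ℝ)) (ε : ℝ) :
    BddBelow (Dk k '' Vset k μ₀ ε) := by
  refine ⟨∑ _ : Fin k, ∑ _ : Fin k, (-1 : ℝ) + 2 * Real.log k, ?_⟩
  rintro _ ⟨A, hA, rfl⟩
  rw [Dk_eq_of_mem_Mk hk hA.1]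
  refine add_le_add (Finset.sum_le_sum fun r _ => Finset.sum_le_sum fun s _ => ?_) le_rfl
  have h0 := hA.1.1 r s
  linarith [Real.self_sub_one_le_mul_log h0]

open scoped Classical in
/-- The number of permutations with block matrix `M`. -/
def numPerm (k n : ℕ) (M : Matrix (Fin k) (Fin k) ℕ) : ℕ :=
  (Finset.univ.filter fun π : Equiv.Perm (Fin n) => Mmat k n π = M).card

theorem numPerm_pos (hk : 0 < k) {M : Matrix (Fin k) (Fin k) ℕ} (hM : M ∈ Mkn k n) :
    0 < numPerm k n M := by
  obtain ⟨π, hπ⟩ := exists_Mmat_eq hk hM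
  exact Finset.card_pos.2 ⟨π, by simpa using hπ⟩

theorem log_numPerm (hk : 0 < k) {M : Matrix (Fin k) (Fin k) ℕ} (hM : M ∈ Mkn k n) :
    Real.log (numPerm k n M) = 2 * ∑ r, Real.log ((Mrow k n r).factorial : ℝ) -
      ∑ r, ∑ s, Real.log ((M r s).factorial : ℝ) := by
  have hpos : (numPerm k n M : ℝ) ≠ 0 := by exact_mod_cast (numPerm_pos hk hM).ne'
  have hf : ∀ m : ℕ, (m.factorial : ℝ) ≠ 0 := fun m => by exact_mod_cast m.factorial_ne_zero
  have h : (numPerm k n M : ℝ) * ∏ r, ∏ s, ((M r s).factorial : ℝ) =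
      (∏ r, ((Mrow k n r).factorial : ℝ)) ^ 2 := by
    exact_mod_cast card_Mmat_eq_mul_prod_factorial hk hM
  have h' := congrArg Real.log h
  have hprod : ∀ r, ∏ s, ((M r s).factorial : ℝ) ≠ 0 := fun r =>
    Finset.prod_ne_zero_iff.2 fun s _ => hf (M r s)
  rw [Real.log_mul hpos (Finset.prod_ne_zero_iff.2 fun r _ => hprod r), Real.log_pow,
    Real.log_prod fun r _ => hprod r, Real.log_prod fun r _ => hf _] at h'
  simp only [Real.log_prod fun (_ : Fin k) _ => hf _] at h'
  push_cast at h'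
  linarith

theorem log_factorial_eq (hn : 0 < n) (m : ℕ) :
    Real.log (m.factorial : ℝ) = n * ((m / n : ℝ) * Real.log (m / n)) + m * Real.log n - m +
      logFactorialError m := by
  have hn' : (n : ℝ) ≠ 0 := by exact_mod_cast hn.ne'
  unfold logFactorialError
  rcases Nat.eq_zero_or_pos m with rfl | hm
  · simp
  have hm' : (m : ℝ) ≠ 0 := by exact_mod_cast hm.ne'
  rw [Real.log_div hm' hn']
  field_simp
  ring

theorem log_numPerm_div_factorial (hk : 0 < k) (hn : 0 < n) {M : Matrix (Fin k) (Fin k) ℕ}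
    (hM : M ∈ Mkn k n) :
    Real.log (numPerm k n M / n.factorial) =
      n * (2 * ∑ r, (Mrow k n r / n : ℝ) * Real.log (Mrow k n r / n) -
        sumMulLog fun r s => (M r s : ℝ) / n) +
      (2 * ∑ r, logFactorialError (Mrow k n r) - ∑ r, ∑ s, logFactorialError (M r s) -
        logFactorialError n) := by
  have hpos : (numPerm k n M : ℝ) ≠ 0 := by exact_mod_cast (numPerm_pos hk hM).ne'
  have hn' : (n : ℝ) ≠ 0 := by exact_mod_cast hn.ne'
  have hsum : ∑ r, (Mrow k n r : ℝ) = n := by exact_mod_cast sum_Mrow hk n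
  have hsum2 : ∀ r, ∑ s, (M r s : ℝ) = Mrow k n r := fun r => by exact_mod_cast hM.1 r
  rw [Real.log_div hpos (by positivity), log_numPerm hk hM, log_factorial_eq hn n]
  simp only [log_factorial_eq hn (Mrow k n _), log_factorial_eq hn (M _ _),
    Finset.sum_add_distrib, Finset.sum_sub_distrib, ← Finset.sum_mul, ← Finset.mul_sum, hsum,
    hsum2, div_self hn', Real.log_one, sumMulLog]
  ring

theorem tendsto_log_add_one_div :
    Tendsto (fun n : ℕ => Real.log ((n : ℝ) + 1) / n) atTop (𝓝 0) := by
  have h1 : Tendsto (fun n : ℕ => Real.log ((n : ℝ) + 1) / ((n : ℝ) + 1)) atTop (𝓝 0) :=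
    (Real.isLittleO_log_id_atTop.tendsto_div_nhds_zero).comp
      (tendsto_atTop_add_const_right _ 1 tendsto_natCast_atTop_atTop)
  have h2 : Tendsto (fun n : ℕ => 1 + 1 / (n : ℝ)) atTop (𝓝 (1 + 0)) :=
    tendsto_const_nhds.add tendsto_one_div_atTop_nhds_zero_nat
  have h := h1.mul h2
  rw [zero_mul] at h
  refine h.congr' ?_
  filter_upwards [eventually_gt_atTop 0] with n hn
  have hn' : (0 : ℝ) < n := by exact_mod_cast hn
  field_simp

/-- Uniform estimate for the probability of a given block matrix. -/
theorem exists_log_numPerm_estimate (hk : 0 < k) :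
    ∃ e : ℕ → ℝ, Tendsto e atTop (𝓝 0) ∧ ∀ n : ℕ, 0 < n → ∀ M ∈ Mkn k n,
      |Real.log (numPerm k n M / n.factorial) / n +
        ((sumMulLog fun r s => (M r s : ℝ) / n) + 2 * Real.log k)| ≤ e n := by
  have hk' : (0 : ℝ) < k := by exact_mod_cast hk
  set g : ℕ → ℝ := fun n => 2 * ∑ r, (Mrow k n r / n : ℝ) * Real.log (Mrow k n r / n) +
    2 * Real.log k with hg
  set K : ℝ := 2 * k + k * k + 1 with hK
  refine ⟨fun n => |g n| + K * (1 / n + Real.log ((n : ℝ) + 1) / n), ?_, ?_⟩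
  · have hg0 : Tendsto g atTop (𝓝 0) := by
      have h : Tendsto g atTop
          (𝓝 (2 * ∑ _ : Fin k, (1 / k : ℝ) * Real.log (1 / k) + 2 * Real.log k)) :=
        ((tendsto_finsetSum Finset.univ fun r _ => (Real.continuous_mul_log.tendsto _).comp
          (tendsto_Mrow_div hk r)).const_mul 2).add_const _
      convert h using 2
      simp
      field_simp
      ring
    have h := hg0.abs.add
      ((tendsto_one_div_atTop_nhds_zero_nat.add tendsto_log_add_one_div).const_mul K)
    simpa using h
  · intro n hn M hM
    have hn' : (0 : ℝ) < n := by exact_mod_cast hn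
    set c : ℝ := 1 + Real.log ((n : ℝ) + 1) with hc
    set E : ℝ := 2 * ∑ r, logFactorialError (Mrow k n r) - ∑ r, ∑ s, logFactorialError (M r s) -
        logFactorialError n with hE
    have e1 : ∑ r, logFactorialError (Mrow k n r) ≤ k * c := by
      refine (Finset.sum_le_sum fun r _ => logFactorialError_le (Mrow_le hk r)).trans_eq ?_
      simp [hc, mul_add]
    have e2 : ∑ r, ∑ s, logFactorialError (M r s) ≤ k * k * c := by
      refine (Finset.sum_le_sum fun r _ => Finset.sum_le_sum fun s _ =>
        logFactorialError_le (entry_le_of_mem_Mkn hk hM r s)).trans_eq ?_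
      simp [hc, mul_assoc, mul_add]
    have e3 : logFactorialError n ≤ c := logFactorialError_le le_rfl
    have p1 : 0 ≤ ∑ r, logFactorialError (Mrow k n r) :=
      Finset.sum_nonneg fun r _ => logFactorialError_nonneg _
    have p2 : 0 ≤ ∑ r, ∑ s, logFactorialError (M r s) :=
      Finset.sum_nonneg fun r _ => Finset.sum_nonneg fun s _ => logFactorialError_nonneg _
    have p3 := logFactorialError_nonneg n
    have hEle : |E| ≤ K * c := by
      rw [abs_le, hK]
      constructor <;> nlinarith
    have heq : Real.log (numPerm k n M / n.factorial) / n +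
        ((sumMulLog fun r s => (M r s : ℝ) / n) + 2 * Real.log k) = g n + E / n := by
      rw [log_numPerm_div_factorial hk hn hM, ← hE, hg]
      field_simp
      ring
    rw [heq]
    refine (abs_add_le _ _).trans (add_le_add le_rfl ?_)
    rw [abs_div, abs_of_pos hn', ← add_div, ← mul_div_assoc]
    exact div_le_div_of_nonneg_right hEle hn'.le

/-- The entropy of an admissible integer matrix cannot be asymptotically lower than the
infimum over `V`. -/
theorem eventually_sInf_sub_lt (hk : 0 < k) {μ₀ : Measure (ℝ × ℝ)} (hμ₀ : μ₀ ∈ MM) {ε : ℝ}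
    (hε : 0 < ε) {δ : ℝ} (hδ : 0 < δ) :
    ∀ᶠ n : ℕ in atTop, ∀ M ∈ Vnset k n μ₀ ε, sInf (Dk k '' Vset k μ₀ ε) - δ <
      (sumMulLog fun r s => (M r s : ℝ) / n) + 2 * Real.log k := by
  by_contra hcon
  obtain ⟨φ, hφ, hM⟩ := extraction_of_frequently_atTop (not_eventually.1 hcon)
  push Not at hM
  choose M hMV hMle using hM
  set B : ℕ → Fin k → Fin k → ℝ := fun j r s => (M j r s : ℝ) / φ j with hB
  obtain ⟨A, -, ψ, hψ, hA⟩ := (isCompact_Icc (a := (0 : Fin k → Fin k → ℝ))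
    (b := 1)).tendsto_subseq (x := B) (fun j => ⟨fun r s => by simp only [hB]; positivity,
      fun r s => div_le_one_of_le₀ (Nat.cast_le.2 (entry_le_of_mem_Mkn hk (hMV j).1 r s))
        (Nat.cast_nonneg _)⟩)
  set m : Fin k → Fin k → ℝ := fun r s => (μ₀ (Trs k r s)).toReal with hm
  have hmMk : m ∈ Mk k := blockMatrix_mem_Mk hk hμ₀
  have hlim : ∀ r s, Tendsto (fun j => B (ψ j) r s) atTop (𝓝 (A r s)) := fun r s =>
    ((continuous_apply_apply r s).tendsto A).comp hA
  have hrow : ∀ r, Tendsto (fun j => (Mrow k (φ (ψ j)) r : ℝ) / φ (ψ j)) atTop (𝓝 (1 / k)) :=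
    fun r => (tendsto_Mrow_div hk r).comp (hφ.comp hψ).tendsto_atTop
  have hA0 : ∀ r s, 0 ≤ A r s := fun r s =>
    ge_of_tendsto' (hlim r s) fun j => by simp only [hB]; positivity
  have hAr : ∀ r, ∑ s, A r s = 1 / k := fun r => by
    refine tendsto_nhds_unique (tendsto_finsetSum Finset.univ fun s _ => hlim r s)
      ((hrow r).congr fun j => ?_)
    simp only [hB]
    rw [← Finset.sum_div, ← (hMV (ψ j)).1.1 r, Nat.cast_sum]
  have hAc : ∀ s, ∑ r, A r s = 1 / k := fun s => by
    refine tendsto_nhds_unique (tendsto_finsetSum Finset.univ fun r _ => hlim r s)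
      ((hrow s).congr fun j => ?_)
    simp only [hB]
    rw [← Finset.sum_div, ← (hMV (ψ j)).1.2 s, Nat.cast_sum]
  have hAm : ∀ r s, |A r s - m r s| ≤ ε := fun r s =>
    le_of_tendsto' ((hlim r s).sub_const _).abs fun j => ((hMV (ψ j)).2 r s).le
  have hup : sumMulLog A + 2 * Real.log k ≤ sInf (Dk k '' Vset k μ₀ ε) - δ :=
    le_of_tendsto' (((continuous_sumMulLog.tendsto A).comp hA).add_const _) fun j => hMle (ψ j)
  have hseg : Tendsto (fun t : ℝ => sumMulLog (fun r s => (1 - t) * A r s + t * m r s) +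
      2 * Real.log k) (𝓝[>] 0) (𝓝 (sumMulLog A + 2 * Real.log k)) := by
    have hcont : Continuous fun t : ℝ => sumMulLog (fun r s => (1 - t) * A r s + t * m r s) +
        2 * Real.log k :=
      (continuous_sumMulLog.comp (by fun_prop)).add continuous_const
    have h := (hcont.tendsto 0).mono_left (nhdsWithin_le_nhds (s := Set.Ioi 0))
    simpa using h
  have hlow : sInf (Dk k '' Vset k μ₀ ε) ≤ sumMulLog A + 2 * Real.log k := by
    refine ge_of_tendsto hseg ?_
    filter_upwards [Ioo_mem_nhdsGT (zero_lt_one' ℝ)] with t ht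
    have hmem : (fun r s => (1 - t) * A r s + t * m r s) ∈ Mk k := by
      refine ⟨fun r s => ?_, fun r => ?_, fun s => ?_⟩
      · exact add_nonneg (mul_nonneg (by linarith [ht.2]) (hA0 r s))
          (mul_nonneg ht.1.le (hmMk.1 r s))
      · rw [Finset.sum_add_distrib, ← Finset.mul_sum, ← Finset.mul_sum, hAr, hmMk.2.1]
        ring
      · rw [Finset.sum_add_distrib, ← Finset.mul_sum, ← Finset.mul_sum, hAc, hmMk.2.2]
        ring
    rw [← Dk_eq_of_mem_Mk hk hmem]
    refine csInf_le (bddBelow_Dk_image hk μ₀ ε) ⟨_, ⟨hmem, fun r s => ?_⟩, rfl⟩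
    have e : (1 - t) * A r s + t * m r s - m r s = (1 - t) * (A r s - m r s) := by ring
    change |(1 - t) * A r s + t * m r s - m r s| < ε
    rw [e, abs_mul, abs_of_pos (by linarith [ht.2])]
    nlinarith [hAm r s, ht.1, ht.2]
  linarith

theorem Vset_nonempty (hk : 0 < k) {μ₀ : Measure (ℝ × ℝ)} (hμ₀ : μ₀ ∈ MM) {ε : ℝ}
    (hε : 0 < ε) : (Vset k μ₀ ε).Nonempty :=
  ⟨fun r s => (μ₀ (Trs k r s)).toReal, blockMatrix_mem_Mk hk hμ₀, fun r s => by simpa using hε⟩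

open scoped Classical in
/-- The number of permutations whose block matrix lies in `V_n`. -/
def numPermNear (k n : ℕ) (μ₀ : Measure (ℝ × ℝ)) (ε : ℝ) : ℕ :=
  (Finset.univ.filter fun π : Equiv.Perm (Fin n) => Mmat k n π ∈ Vnset k n μ₀ ε).card

theorem numPerm_le_numPermNear {μ₀ : Measure (ℝ × ℝ)} {ε : ℝ} {M : Matrix (Fin k) (Fin k) ℕ}
    (hM : M ∈ Vnset k n μ₀ ε) : numPerm k n M ≤ numPermNear k n μ₀ ε := by
  refine Finset.card_le_card fun π hπ => ?_
  simp only [Finset.mem_filter, Finset.mem_univ, true_and] at hπ ⊢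
  rwa [hπ]

theorem numPermNear_le (hk : 0 < k) {μ₀ : Measure (ℝ × ℝ)} {ε C : ℝ} (hC : 0 ≤ C)
    (h : ∀ M ∈ Vnset k n μ₀ ε, (numPerm k n M : ℝ) ≤ C) :
    (numPermNear k n μ₀ ε : ℝ) ≤ ((n : ℝ) + 1) ^ (k * k) * C := by
  classical
  let t' : Finset (Fin k → Fin k → ℕ) :=
    Fintype.piFinset fun _ => Fintype.piFinset fun _ => Finset.range (n + 1)
  have hcard' : (t'.card : ℝ) = ((n : ℝ) + 1) ^ (k * k) := by
    simp [t', pow_mul]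
  obtain ⟨t, ht, hcard⟩ : ∃ t : Finset (Matrix (Fin k) (Fin k) ℕ),
      (∀ M, (∀ r s, M r s ≤ n) → M ∈ t) ∧ (t.card : ℝ) = ((n : ℝ) + 1) ^ (k * k) :=
    ⟨t', fun M hM => Fintype.mem_piFinset.2 fun r => Fintype.mem_piFinset.2 fun s =>
      Finset.mem_range_succ_iff.2 (hM r s), hcard'⟩
  rw [numPermNear, Finset.card_eq_sum_card_fiberwise (f := Mmat k n) (t := t)]
  · rw [← hcard, ← nsmul_eq_mul]
    rw [Nat.cast_sum]
    refine Finset.sum_le_card_nsmul t _ C fun M _ => ?_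
    by_cases hM : M ∈ Vnset k n μ₀ ε
    · refine le_trans ?_ (h M hM)
      rw [numPerm, Nat.cast_le]
      refine Finset.card_le_card fun π hπ => ?_
      simp only [Finset.mem_filter, Finset.mem_univ, true_and] at hπ ⊢
      exact hπ.2
    · rw [Finset.card_eq_zero.2]
      · simpa using hC
      · refine Finset.filter_eq_empty_iff.2 fun π hπ hπM => hM ?_
        rw [← hπM]
        simpa using hπ
  · intro π _
    exact ht _ (entry_le_of_mem_Mkn hk (Mmat_mem_Mkn hk π))

theorem eventually_lt_log_numPermNear (hk : 0 < k) {μ₀ : Measure (ℝ × ℝ)} (hμ₀ : μ₀ ∈ MM)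
    {ε : ℝ} (hε : 0 < ε) {a : ℝ} (ha : a < -sInf (Dk k '' Vset k μ₀ ε)) :
    ∀ᶠ n : ℕ in atTop, 0 < numPermNear k n μ₀ ε ∧
      a < Real.log (numPermNear k n μ₀ ε / n.factorial) / n := by
  obtain ⟨e, he, hest⟩ := exists_log_numPerm_estimate hk
  obtain ⟨_, ⟨A, hA, rfl⟩, hAa⟩ := exists_lt_of_csInf_lt
    ((Vset_nonempty hk hμ₀ hε).image (Dk k)) (lt_neg_of_lt_neg ha)
  obtain ⟨M, hM, hMA⟩ := exists_mem_Mkn_tendsto hk hA.1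
  have hV : ∀ᶠ n in atTop, M n ∈ Vnset k n μ₀ ε := by
    have h : ∀ᶠ n : ℕ in atTop, ∀ r s, |(M n r s : ℝ) / n - (μ₀ (Trs k r s)).toReal| < ε :=
      eventually_all.2 fun r => eventually_all.2 fun s =>
        ((hMA r s).sub_const _).abs.eventually_lt_const (hA.2 r s)
    exact h.mono fun n hn => ⟨hM n, hn⟩
  have hlim : Tendsto (fun n : ℕ => -((sumMulLog fun r s => (M n r s : ℝ) / n) +
      2 * Real.log k) - e n) atTop (𝓝 (-Dk k A)) := by
    have hB : Tendsto (fun (n : ℕ) r s => (M n r s : ℝ) / n) atTop (𝓝 (A : Fin k → Fin k → ℝ)) :=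
      tendsto_pi_nhds.2 fun r => tendsto_pi_nhds.2 fun s => hMA r s
    have h := (((continuous_sumMulLog.tendsto _).comp hB).add_const (2 * Real.log k)).neg.sub he
    rwa [sub_zero, ← Dk_eq_of_mem_Mk hk hA.1] at h
  filter_upwards [hV, hlim.eventually_const_lt (lt_neg_of_lt_neg hAa), eventually_gt_atTop 0]
    with n hnV hna hn
  have hpos := numPerm_pos hk (hM n)
  have hle := numPerm_le_numPermNear hnV
  refine ⟨hpos.trans_le hle, hna.trans_le ?_⟩
  have h1 := (abs_le.1 (hest n hn (M n) (hM n))).1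
  have hpos' : (0 : ℝ) < numPerm k n (M n) := by exact_mod_cast hpos
  have h2 : Real.log (numPerm k n (M n) / n.factorial) / n ≤
      Real.log (numPermNear k n μ₀ ε / n.factorial) / n := by
    gcongr
  linarith

theorem eventually_log_numPermNear_lt (hk : 0 < k) {μ₀ : Measure (ℝ × ℝ)} (hμ₀ : μ₀ ∈ MM)
    {ε : ℝ} (hε : 0 < ε) {b : ℝ} (hb : -sInf (Dk k '' Vset k μ₀ ε) < b) :
    ∀ᶠ n : ℕ in atTop, Real.log (numPermNear k n μ₀ ε / n.factorial) / n < b := by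
  obtain ⟨e, he, hest⟩ := exists_log_numPerm_estimate hk
  set I : ℝ := sInf (Dk k '' Vset k μ₀ ε) with hI
  have hδ : 0 < (b + I) / 2 := by linarith
  have hlim : Tendsto (fun n : ℕ => ((k * k : ℕ) : ℝ) * (Real.log ((n : ℝ) + 1) / n) +
      (e n - (I - (b + I) / 2))) atTop (𝓝 (((k * k : ℕ) : ℝ) * 0 + (0 - (I - (b + I) / 2)))) :=
    (tendsto_log_add_one_div.const_mul _).add (he.sub_const _)
  filter_upwards [eventually_sInf_sub_lt hk hμ₀ hε hδ,
    eventually_lt_log_numPermNear hk hμ₀ hε (sub_one_lt (-I)), eventually_gt_atTop 0,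
    hlim.eventually_lt_const (show _ < b by linarith)] with n hmin hpos hn hnb
  refine lt_of_le_of_lt ?_ hnb
  have hn' : (0 : ℝ) < n := by exact_mod_cast hn
  have hf : (0 : ℝ) < n.factorial := by exact_mod_cast n.factorial_pos
  have hpos' : (0 : ℝ) < numPermNear k n μ₀ ε := by exact_mod_cast hpos.1
  set x : ℝ := e n - (I - (b + I) / 2) with hx
  have hle : (numPermNear k n μ₀ ε : ℝ) ≤
      ((n : ℝ) + 1) ^ (k * k) * (n.factorial * Real.exp (n * x)) := by
    refine numPermNear_le hk (by positivity) fun M hM => ?_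
    have hMpos : (0 : ℝ) < numPerm k n M := by exact_mod_cast numPerm_pos hk hM.1
    have h1 := (abs_le.1 (hest n hn M hM.1)).2
    have h2 := hmin M hM
    have h3 : Real.log (numPerm k n M / n.factorial) / n ≤ x := by linarith
    rw [div_le_iff₀ hn', Real.log_le_iff_le_exp (by positivity), div_le_iff₀ hf] at h3
    rw [mul_comm (n : ℝ) x, mul_comm]
    exact h3
  have h4 : (numPermNear k n μ₀ ε / n.factorial : ℝ) ≤
      ((n : ℝ) + 1) ^ (k * k) * Real.exp (n * x) := by
    rw [div_le_iff₀ hf]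
    linarith
  have h5 := Real.log_le_log (by positivity) h4
  rw [Real.log_mul (by positivity) (Real.exp_pos _).ne', Real.log_pow, Real.log_exp] at h5
  rw [div_le_iff₀ hn']
  refine h5.trans_eq ?_
  field_simp

end Entropy

open scoped Classical in
/-- **Statement 19.** For a uniformly random permutation,
`(1/n) log P_n(M(π) ∈ V_n[k,μ₀](ε)) → − inf_{A ∈ V[k,μ₀](ε)} D_k(A)`. -/
theorem block_empirical_LDP (k : ℕ) (hk : 0 < k) (μ₀ : Measure (ℝ × ℝ)) (hμ₀ : μ₀ ∈ MM)
    (ε : ℝ) (hε : 0 < ε) :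
    Tendsto
      (fun n : ℕ =>
        Real.log
          (((Finset.univ.filter
              (fun π : Equiv.Perm (Fin n) => Mmat k n π ∈ Vnset k n μ₀ ε)).card : ℝ) /
            (Nat.factorial n : ℝ)) / n)
      atTop (𝓝 (-sInf (Dk k '' Vset k μ₀ ε))) := by
  exact tendsto_order.2
    ⟨fun a ha => (eventually_lt_log_numPermNear hk hμ₀ hε ha).mono fun n h => h.2,
      fun b hb => eventually_log_numPermNear_lt hk hμ₀ hε hb⟩
end
end
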